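/- arXiv:1907.09577 — 8 statements merged into one kernel-verified Lean document; each statement's English description precedes it below -/
import Mathlib

section
/- The class 𝒢_A fails the cofinal amalgamation property in the following strong form: for every G ∈ 𝒢_A containing at least one edge and every G' ∈ 𝒢_A containing G as an induced subgraph, there exist X, Y ∈ 𝒢_A and graph embeddings f : G' → X and g : G' → Y such that there is no W ∈ 𝒢_A with graph embeddings f' : X → W and g' : Y → W satisfying f' ∘ f = g' ∘ g. -/
/-- The degree of a vertex (as the cardinality of its neighbor set). -/
noncomputable def deg {V : Type} (G : SimpleGraph V) (v : V) : ℕ :=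
  {w | G.Adj v w}.ncard

/-- The class `𝒢_A`: finite simple graphs in which every cycle has length in `A`,
no two distinct cycles share an edge, and every cycle contains at most two vertices of
degree greater than `2`. -/
def inGA (A : Set ℕ) {V : Type} (G : SimpleGraph V) : Prop :=
  Finite V ∧
  (∀ (v : V) (c : G.Walk v v), c.IsCycle → c.length ∈ A) ∧
  (∀ (v v' : V) (c : G.Walk v v) (c' : G.Walk v' v'), c.IsCycle → c'.IsCycle →
    (∃ e, e ∈ c.edges ∧ e ∈ c'.edges) → ∀ e, e ∈ c.edges ↔ e ∈ c'.edges) ∧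
  (∀ (v : V) (c : G.Walk v v), c.IsCycle → {u | u ∈ c.support ∧ 2 < deg G u}.ncard ≤ 2)

namespace SimpleGraph

open Walk

variable {V V' : Type} {G : SimpleGraph V}

/-- A vertex on a cycle is incident to exactly two edges of that cycle. -/
theorem Walk.IsCycle.ncard_incident {v u : V} {c : G.Walk v v} (hc : c.IsCycle)
    (hu : u ∈ c.support) : {w | s(u, w) ∈ c.edges}.ncard = 2 := by
  have h := hc.ncard_neighborSet_toSubgraph_eq_two hu
  have : c.toSubgraph.neighborSet u = {w | s(u, w) ∈ c.edges} := by
    ext w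
    simp [adj_toSubgraph_iff_mem_edges]
  rwa [this] at h

theorem Walk.IsCycle.two_le_deg [Finite V] {v u : V} {c : G.Walk v v} (hc : c.IsCycle)
    (hu : u ∈ c.support) : 2 ≤ deg G u := by
  rw [← hc.ncard_incident hu]
  exact Set.ncard_le_ncard (fun w hw => c.adj_of_mem_edges hw) (Set.toFinite _)

theorem Walk.IsCycle.two_lt_deg [Finite V] {v u w : V} {c : G.Walk v v} (hc : c.IsCycle)
    (hu : u ∈ c.support) (hw : G.Adj u w) (hn : s(u, w) ∉ c.edges) : 2 < deg G u := by
  rw [← hc.ncard_incident hu]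
  refine Set.ncard_lt_ncard ⟨fun w hw => c.adj_of_mem_edges hw, fun h => hn (h hw)⟩ (Set.toFinite _)

theorem Walk.IsCycle.exists_adj_notMem_edges {v u : V} {c : G.Walk v v}
    (hc : c.IsCycle) (hu : u ∈ c.support) (hd : 2 < deg G u) :
    ∃ w, G.Adj u w ∧ s(u, w) ∉ c.edges := by
  by_contra! h
  rw [← hc.ncard_incident hu] at hd
  refine absurd hd (not_lt.2 (Set.ncard_le_ncard (fun w hw => h w hw) ?_))
  exact Set.finite_of_ncard_pos (by rw [hc.ncard_incident hu]; norm_num)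

/-- A cycle through the edge `s(s, t)` consists of that edge and a path from `t` to `s`. -/
theorem Walk.IsCycle.exists_path {v s t : V} {c : G.Walk v v} (hc : c.IsCycle)
    (he : s(s, t) ∈ c.edges) :
    ∃ q : G.Walk t s, q.IsPath ∧ s(s, t) ∉ q.edges ∧ c.length = q.length + 1 ∧
      (∀ e, e ∈ c.edges ↔ e = s(s, t) ∨ e ∈ q.edges) ∧ ∀ x, x ∈ c.support ↔ x ∈ q.support := by
  classical
  have key : ∀ c' : G.Walk s s, c'.IsCycle → c'.snd = t →
      ∃ q : G.Walk t s, q.IsPath ∧ s(s, t) ∉ q.edges ∧ c'.length = q.length + 1 ∧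
      (∀ e, e ∈ c'.edges ↔ e = s(s, t) ∨ e ∈ q.edges) ∧ ∀ x, x ∈ c'.support ↔ x ∈ q.support := by
    intro c' hc' h
    cases c' with
    | nil => exact absurd hc' (by simp)
    | cons hadj q =>
      simp only [snd_cons] at h
      subst h
      rw [cons_isCycle_iff] at hc'
      refine ⟨q, hc'.1, hc'.2, by simp, by simp, ?_⟩
      intro x
      simp only [support_cons, List.mem_cons, or_iff_right_iff_imp]
      rintro rfl
      simp
  have hs : s ∈ c.support := c.fst_mem_support_of_mem_edges he
  have hr := hc.rotate hs
  have ht : t = (c.rotate s hs).snd ∨ t = (c.rotate s hs).penultimate := by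
    have h := hr.neighborSet_toSubgraph_endpoint
    have : t ∈ (c.rotate s hs).toSubgraph.neighborSet s := by
      rw [toSubgraph_rotate]
      simpa [adj_toSubgraph_iff_mem_edges] using he
    rw [h] at this
    simpa using this
  have hE : ∀ e, e ∈ (c.rotate s hs).edges ↔ e ∈ c.edges := fun e => (c.rotate_edges s hs).mem_iff
  rcases ht with ht | ht
  · obtain ⟨q, h1, h2, h3, h4, h5⟩ := key _ hr ht.symm
    exact ⟨q, h1, h2, by simpa using h3, fun e => by rw [← h4, hE],
      fun x => by rw [← h5, mem_support_rotate_iff]⟩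
  · obtain ⟨q, h1, h2, h3, h4, h5⟩ := key _ hr.reverse (by rw [snd_reverse, ht])
    refine ⟨q, h1, h2, by simpa using h3, fun e => ?_, fun x => ?_⟩
    · rw [← h4, edges_reverse, List.mem_reverse, hE]
    · rw [← h5, support_reverse, List.mem_reverse, mem_support_rotate_iff]

/-- A path all of whose edges are bridges is the only path between its ends. -/
theorem Walk.IsPath.eq_of_forall_isBridge {s t : V} {p q : G.Walk s t} (hp : p.IsPath)
    (hb : ∀ e ∈ p.edges, G.IsBridge e) (hq : q.IsPath) : q = p := by
  induction p with
  | nil => exact (isPath_iff_nil.1 hq).eq_nil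
  | @cons s x t h p ih =>
    cases q with
    | nil => simp at hp
    | @cons _ y _ h2 q =>
      rw [cons_isPath_iff] at hp hq
      by_cases hxy : y = x
      · subst hxy
        rw [ih hp.1 (fun e he => hb e (by simp [he])) hq.1]
      · exfalso
        have hbr := hb s(s, x) (by simp)
        rw [isBridge_iff_forall_walk_mem_edges] at hbr
        have := hbr ((cons h2 q).append p.reverse)
        simp only [edges_append, edges_cons, edges_reverse, List.mem_append, List.mem_cons,
          List.mem_reverse] at this
        rcases this with (hmem | hmem) | hmem
        · simp at hmem
          rcases hmem with hmem | ⟨rfl, hmem⟩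
          · exact hxy hmem.symm
          · exact h.ne hmem.symm
        · exact hq.2 (q.fst_mem_support_of_mem_edges hmem)
        · exact hp.2 (p.fst_mem_support_of_mem_edges hmem)

/-- A walk in the range of an induced embedding lifts. -/
theorem Walk.exists_map_eq {H : SimpleGraph V'} (f : G ↪g H) {x y : V'} (w : H.Walk x y)
    (hw : ∀ z ∈ w.support, z ∈ Set.range f) {a b : V} (ha : f a = x) (hb : f b = y) :
    ∃ w' : G.Walk a b, w = (w'.map f.toHom).copy ha hb := by
  induction w generalizing a with
  | nil =>
    subst ha
    obtain rfl := f.injective hb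
    exact ⟨nil, rfl⟩
  | @cons x z y h w ih =>
    obtain ⟨d, rfl⟩ := hw z (by simp)
    subst ha hb
    obtain ⟨w', hw'⟩ := ih (fun z hz => hw z (by simp [hz])) rfl rfl
    exact ⟨cons (f.map_adj_iff.1 h) w', by rw [hw']; rfl⟩

theorem Walk.IsCycle.exists_map_eq {H : SimpleGraph V'} (f : G ↪g H) {x : V'} {c : H.Walk x x}
    (hc : c.IsCycle) (h : ∀ z ∈ c.support, z ∈ Set.range f) :
    ∃ (a : V) (c' : G.Walk a a), c'.IsCycle ∧ c.length = c'.length ∧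
      c.edges = c'.edges.map (Sym2.map f) ∧ c.support = c'.support.map f := by
  obtain ⟨a, rfl⟩ := h x (by simp)
  obtain ⟨c', rfl⟩ := c.exists_map_eq f h rfl rfl
  refine ⟨a, c', ?_, ?_, ?_, ?_⟩
  · exact (isCycle_map_iff_of_injective (f := f.toHom) f.injective).1 (by simpa using hc)
  · simp
  · simp
  · simp

theorem deg_le_deg_map [Finite V'] {H : SimpleGraph V'} (f : G ↪g H) (v : V) :
    deg G v ≤ deg H (f v) := by
  refine Set.ncard_le_ncard_of_injOn f (fun w hw => ?_) f.injective.injOn (Set.toFinite _)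
  exact f.map_adj_iff.2 hw

/-- The graph `H` with a new vertex `none` attached to `x`. -/
def addPendant (H : SimpleGraph V) (x : V) : SimpleGraph (Option V) :=
  H.map Function.Embedding.some ⊔ edge none (some x)

section addPendant

variable (H : SimpleGraph V) (x : V)

theorem addPendant_adj_some {a b : V} : (H.addPendant x).Adj (some a) (some b) ↔ H.Adj a b := by
  simp only [addPendant, sup_adj, map_adj, edge_adj]
  aesop

theorem addPendant_adj_none {b : Option V} : (H.addPendant x).Adj none b ↔ b = some x := by
  simp only [addPendant, sup_adj, map_adj, edge_adj]
  aesop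

/-- The inclusion of a graph in its extension by a pendant vertex. -/
def addPendantEmbedding : H ↪g H.addPendant x :=
  ⟨Function.Embedding.some, addPendant_adj_some H x⟩

@[simp] theorem addPendantEmbedding_apply (a : V) : H.addPendantEmbedding x a = some a := rfl

variable {H x}

theorem Walk.IsCycle.none_notMem_support {v : Option V} {c : (H.addPendant x).Walk v v}
    (hc : c.IsCycle) : none ∉ c.support := by
  intro h
  have h2 := hc.ncard_incident h
  have : {w | s(none, w) ∈ c.edges} ⊆ {some x} := fun w hw =>
    (addPendant_adj_none H x).1 (c.adj_of_mem_edges hw)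
  have := Set.ncard_le_ncard this
  rw [h2, Set.ncard_singleton] at this
  omega

theorem Walk.IsCycle.exists_of_addPendant {v : Option V} {c : (H.addPendant x).Walk v v}
    (hc : c.IsCycle) : ∃ (a : V) (c' : H.Walk a a), c'.IsCycle ∧ c.length = c'.length ∧
      c.edges = c'.edges.map (Sym2.map some) ∧ c.support = c'.support.map some := by
  refine hc.exists_map_eq (H.addPendantEmbedding x) fun z hz => ?_
  cases z with
  | none => exact absurd hz hc.none_notMem_support
  | some z => exact ⟨z, rfl⟩

theorem deg_addPendant_of_ne {y : V} (hy : y ≠ x) : deg (H.addPendant x) (some y) = deg H y := by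
  have : {w | (H.addPendant x).Adj (some y) w} = some '' {w | H.Adj y w} := by
    ext w
    cases w with
    | none => simp [adj_comm _ _ none, addPendant_adj_none, hy]
    | some w => simp [addPendant_adj_some]
  rw [deg, this, Set.ncard_image_of_injective _ (Option.some_injective _), deg]

theorem deg_addPendant_self [Finite V] : deg (H.addPendant x) (some x) = deg H x + 1 := by
  have : {w | (H.addPendant x).Adj (some x) w} = insert none (some '' {w | H.Adj x w}) := by
    ext w
    cases w with
    | none => simp [adj_comm _ _ none, addPendant_adj_none]
    | some w => simp [addPendant_adj_some]
  rw [deg, this, Set.ncard_insert_of_notMem (by simp) (Set.toFinite _),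
    Set.ncard_image_of_injective _ (Option.some_injective _), deg]

theorem deg_addPendant_none : deg (H.addPendant x) none = 1 := by
  have : {w | (H.addPendant x).Adj none w} = {some x} := by
    ext w
    simp [addPendant_adj_none]
  rw [deg, this, Set.ncard_singleton]

theorem inGA_addPendant {A : Set ℕ} (hH : inGA A H)
    (hx : ∀ (v : V) (c : H.Walk v v), c.IsCycle → x ∈ c.support →
      (insert x {u | u ∈ c.support ∧ 2 < deg H u}).ncard ≤ 2) :
    inGA A (H.addPendant x) := by
  obtain ⟨hfin, hlen, hshare, hbr⟩ := hH
  refine ⟨inferInstance, fun v c hc => ?_, fun v v' c c' hc hc' he => ?_, fun v c hc => ?_⟩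
  · obtain ⟨a, d, hd, hl, -, -⟩ := hc.exists_of_addPendant
    rw [hl]
    exact hlen a d hd
  · obtain ⟨a, d, hd, -, hE, -⟩ := hc.exists_of_addPendant
    obtain ⟨a', d', hd', -, hE', -⟩ := hc'.exists_of_addPendant
    have hinj : Function.Injective (Sym2.map (some : V → Option V)) :=
      Sym2.map.injective (Option.some_injective _)
    rw [hE, hE'] at he ⊢
    obtain ⟨_, h1, h2⟩ := he
    obtain ⟨e, h1', rfl⟩ := List.mem_map.1 h1
    rw [List.mem_map_of_injective hinj] at h2
    have := hshare a a' d d' hd hd' ⟨e, h1', h2⟩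
    simp [List.mem_map, this]
  · obtain ⟨a, d, hd, -, -, hS⟩ := hc.exists_of_addPendant
    rw [hS]
    by_cases hxd : x ∈ d.support
    · refine le_trans (Set.ncard_le_ncard (t := some '' insert x {u | u ∈ d.support ∧ 2 < deg H u})
        ?_ (Set.toFinite _)) ?_
      · rintro u ⟨hu, hu2⟩
        obtain ⟨u, hud, rfl⟩ := List.mem_map.1 hu
        refine ⟨u, ?_, rfl⟩
        by_cases hux : u = x
        · exact Or.inl hux
        · rw [deg_addPendant_of_ne hux] at hu2
          exact Or.inr ⟨hud, hu2⟩
      · rw [Set.ncard_image_of_injective _ (Option.some_injective _)]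
        exact hx a d hd hxd
    · refine le_trans (Set.ncard_le_ncard (t := some '' {u | u ∈ d.support ∧ 2 < deg H u})
        ?_ (Set.toFinite _)) ?_
      · rintro u ⟨hu, hu2⟩
        obtain ⟨u, hud, rfl⟩ := List.mem_map.1 hu
        refine ⟨u, ⟨hud, ?_⟩, rfl⟩
        rwa [deg_addPendant_of_ne (by rintro rfl; exact hxd hud)] at hu2
      · rw [Set.ncard_image_of_injective _ (Option.some_injective _)]
        exact hbr a d hd

/-- Attaching a pendant vertex at a vertex which is already a branch vertex of every cycle
through it keeps the graph in the class. -/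
theorem inGA_addPendant_of_isBridge {A : Set ℕ} (hH : inGA A H) {y : V} (hxy : H.Adj x y)
    (hb : H.IsBridge s(x, y)) : inGA A (H.addPendant x) := by
  refine inGA_addPendant hH fun v c hc hx => ?_
  have := hH.1
  have hx2 := hc.two_lt_deg hx hxy (hb.notMem_edges_of_isCycle hc)
  rw [Set.insert_eq_of_mem (show x ∈ {u | u ∈ c.support ∧ 2 < deg H u} from ⟨hx, hx2⟩)]
  exact hH.2.2.2 v c hc

/-- Two cycles of a graph in the class that meet in a vertex of degree at most two agree. -/
theorem mem_support_iff_of_deg_le {A : Set ℕ} (hH : inGA A H) {v v' : V} {c : H.Walk v v}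
    {d : H.Walk v' v'} (hc : c.IsCycle) (hd : d.IsCycle) (hxc : x ∈ c.support)
    (hxd : x ∈ d.support) (hx : deg H x ≤ 2) (u : V) : u ∈ c.support ↔ u ∈ d.support := by
  have := hH.1
  have h : ∃ e, e ∈ c.edges ∧ e ∈ d.edges := by
    obtain ⟨e, he, hxe⟩ := (mem_support_iff_exists_mem_edges_of_not_nil hc.not_nil).1 hxc
    obtain ⟨y, rfl⟩ := hxe
    refine ⟨_, he, ?_⟩
    by_contra hn
    have := hd.two_lt_deg hxd (c.adj_of_mem_edges he) hn
    omega
  rw [mem_support_iff_exists_mem_edges_of_not_nil hc.not_nil,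
    mem_support_iff_exists_mem_edges_of_not_nil hd.not_nil]
  simp [hH.2.2.1 v v' c d hc hd h]

theorem inGA_addPendant_of_isCycle {A : Set ℕ} (hH : inGA A H) {v : V} {d : H.Walk v v}
    (hd : d.IsCycle) (hx : x ∈ d.support)
    (hn : (insert x {u | u ∈ d.support ∧ 2 < deg H u}).ncard ≤ 2) :
    inGA A (H.addPendant x) := by
  refine inGA_addPendant hH fun v' c hc hxc => ?_
  by_cases hdeg : 2 < deg H x
  · rw [Set.insert_eq_of_mem (show x ∈ {u | u ∈ c.support ∧ 2 < deg H u} from ⟨hxc, hdeg⟩)]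
    exact hH.2.2.2 v' c hc
  · simpa only [mem_support_iff_of_deg_le hH hc hd hxc hx (not_lt.1 hdeg)] using hn

theorem isBridge_addPendant_map {e : Sym2 V} (he : e ∈ H.edgeSet) (hb : H.IsBridge e) :
    (H.addPendant x).IsBridge (e.map some) := by
  have he' : e.map some ∈ (H.addPendant x).edgeSet := by
    induction e with
    | h a b => exact (addPendant_adj_some H x).2 he
  rw [isBridge_iff_forall_cycle_notMem he']
  intro u c hc h
  obtain ⟨a, d, hd, -, hE, -⟩ := hc.exists_of_addPendant
  rw [hE, List.mem_map_of_injective (Sym2.map.injective (Option.some_injective _))] at h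
  exact hb.notMem_edges_of_isCycle hd h

theorem isBridge_addPendant_none : (H.addPendant x).IsBridge s(none, some x) := by
  have he' : s(none, some x) ∈ (H.addPendant x).edgeSet := (addPendant_adj_none H x).2 rfl
  rw [isBridge_iff_forall_cycle_notMem he']
  intro u c hc h
  exact hc.none_notMem_support (c.fst_mem_support_of_mem_edges h)

end addPendant

section addEdge

variable {H : SimpleGraph V}

theorem deg_sup_edge_of_ne {s t y : V} (hs : y ≠ s) (ht : y ≠ t) :
    deg (H ⊔ edge s t) y = deg H y := by
  simp [deg, edge_adj, hs, ht]

theorem deg_sup_edge_le [Finite V] (s t y : V) : deg (H ⊔ edge s t) y ≤ deg H y + 1 := by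
  have : ∃ z, {w | (H ⊔ edge s t).Adj y w} ⊆ insert z {w | H.Adj y w} := by
    by_cases h : y = s
    · refine ⟨t, fun w hw => ?_⟩
      simp only [Set.mem_ofPred_eq, sup_adj, edge_adj] at hw
      simp only [Set.mem_insert_iff, Set.mem_ofPred_eq]
      grind
    · refine ⟨s, fun w hw => ?_⟩
      simp only [Set.mem_ofPred_eq, sup_adj, edge_adj] at hw
      simp only [Set.mem_insert_iff, Set.mem_ofPred_eq]
      grind
  obtain ⟨z, hz⟩ := this
  exact (Set.ncard_le_ncard hz (Set.toFinite _)).trans (Set.ncard_insert_le _ _)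

theorem isCycle_sup_edge_cases {s t v : V} {p : H.Walk s t} (hp : p.IsPath)
    (hb : ∀ e ∈ p.edges, H.IsBridge e) {c : (H ⊔ edge s t).Walk v v} (hc : c.IsCycle) :
    (∃ c' : H.Walk v v, c'.IsCycle ∧ c'.edges = c.edges ∧ c'.support = c.support ∧
      c'.length = c.length) ∨
    (c.length = p.length + 1 ∧ (∀ e, e ∈ c.edges ↔ e = s(s, t) ∨ e ∈ p.edges) ∧
      ∀ x, x ∈ c.support ↔ x ∈ p.support) := by
  have hle : ∀ e ∈ (H ⊔ edge s t).edgeSet, e ≠ s(s, t) → e ∈ H.edgeSet := by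
    intro e he hne
    rw [edgeSet_sup] at he
    rcases he with he | he
    · exact he
    · exact absurd (edgeSet_edge_subset he) hne
  by_cases he : s(s, t) ∈ c.edges
  · right
    obtain ⟨q, hq, hn, hl, hE, hS⟩ := hc.exists_path he
    have hqH : ∀ e ∈ q.edges, e ∈ H.edgeSet := fun e h =>
      hle e (q.edges_subset_edgeSet h) (by rintro rfl; exact hn h)
    have heq := hp.eq_of_forall_isBridge hb (hq.transfer hqH).reverse
    subst heq
    simp [hl, hE, hS]
  · left
    have hcH : ∀ e ∈ c.edges, e ∈ H.edgeSet := fun e h =>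
      hle e (c.edges_subset_edgeSet h) (by rintro rfl; exact he h)
    exact ⟨c.transfer H hcH, hc.transfer hcH, by simp, by simp, by simp⟩

theorem inGA_sup_edge {A : Set ℕ} (hH : inGA A H) {s t : V} {p : H.Walk s t} (hp : p.IsPath)
    (hb : ∀ e ∈ p.edges, H.IsBridge e) (hl : p.length + 1 ∈ A) (hl0 : p.length ≠ 0)
    (hd : {u | u ∈ p.support ∧ 2 < deg (H ⊔ edge s t) u}.ncard ≤ 2) :
    inGA A (H ⊔ edge s t) := by
  obtain ⟨hfin, hlen, hshare, hbr⟩ := hH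
  have hnil : ¬ p.Nil := by rwa [← length_eq_zero_iff]
  refine ⟨hfin, fun v c hc => ?_, fun v v' c c' hc hc' he => ?_, fun v c hc => ?_⟩
  · rcases isCycle_sup_edge_cases hp hb hc with ⟨d, hd, -, -, h⟩ | ⟨h, -, -⟩
    · exact h ▸ hlen v d hd
    · exact h ▸ hl
  · have mixed : ∀ {w} {d : H.Walk w w}, d.IsCycle → ∀ e ∈ d.edges,
        ¬ (e = s(s, t) ∨ e ∈ p.edges) := by
      rintro w d hd e he (rfl | h)
      · have := hp.eq_of_forall_isBridge hb (q := cons (d.adj_of_mem_edges he) nil)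
          (by simpa using (d.adj_of_mem_edges he).ne)
        refine (hb s(s, t) ?_).notMem_edges_of_isCycle hd he
        simp [← this]
      · exact (hb e h).notMem_edges_of_isCycle hd he
    obtain ⟨e, he, he'⟩ := he
    rcases isCycle_sup_edge_cases hp hb hc with ⟨d, hd, hE, -, -⟩ | ⟨-, hE, -⟩ <;>
    rcases isCycle_sup_edge_cases hp hb hc' with ⟨d', hd', hE', -, -⟩ | ⟨-, hE', -⟩
    · rw [← hE] at he ⊢
      rw [← hE'] at he' ⊢
      exact hshare v v' d d' hd hd' ⟨e, he, he'⟩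
    · rw [← hE] at he
      exact absurd ((hE' e).1 he') (mixed hd e he)
    · rw [← hE'] at he'
      exact absurd ((hE e).1 he) (mixed hd' e he')
    · intro e
      rw [hE, hE']
  · rcases isCycle_sup_edge_cases hp hb hc with ⟨d, hcd, hE, hS, -⟩ | ⟨-, -, hS⟩
    · refine le_trans (Set.ncard_le_ncard ?_ (Set.toFinite _)) (hbr v d hcd)
      rintro u ⟨hu, hu2⟩
      rw [← hS] at hu
      refine ⟨hu, ?_⟩
      by_cases hus : u = s
      · subst hus
        exact hcd.two_lt_deg hu (p.adj_snd hnil)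
          ((hb _ (p.mk_start_snd_mem_edges hnil)).notMem_edges_of_isCycle hcd)
      by_cases hut : u = t
      · subst hut
        refine hcd.two_lt_deg hu (p.adj_penultimate hnil).symm ?_
        rw [Sym2.eq_swap]
        exact (hb _ (p.mk_penultimate_end_mem_edges hnil)).notMem_edges_of_isCycle hcd
      rwa [deg_sup_edge_of_ne hus hut] at hu2
    · simpa only [hS] using hd

end addEdge

variable {A : Set ℕ}

/-- Pendant vertices can be attached one after another to lengthen a bridge `s(u, v)` to a path of
bridges whose vertices other than `u` and `v` have degree at most two. -/
theorem exists_bridge_path (hG : inGA A G) {u v : V} (huv : G.Adj u v) (hb : G.IsBridge s(u, v))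
    (m : ℕ) : ∃ (W : Type) (H : SimpleGraph W) (f : G ↪g H) (s y t : W) (p : H.Walk s t),
      f u = y ∧ f v = t ∧
      inGA A H ∧ p.IsPath ∧ (∀ e ∈ p.edges, H.IsBridge e) ∧ p.length = m + 1 ∧
      s(y, t) ∈ p.edges ∧ (∀ x ∈ p.support, x ≠ y → x ≠ t → deg H x ≤ 2) ∧
      (s ≠ y → deg H s ≤ 1 ∧ s ∉ Set.range f) := by
  induction m with
  | zero =>
    refine ⟨V, G, Embedding.refl, u, u, v, cons huv nil, rfl, rfl, hG, ?_, ?_, rfl, ?_, ?_, ?_⟩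
    · simpa using huv.ne
    · simpa using hb
    · simp
    · intro x hx h1 h2
      simp only [support_cons, support_nil, List.mem_cons, List.not_mem_nil, or_false] at hx
      exact (hx.elim h1 h2).elim
    · exact fun h => absurd rfl h
  | succ m ih =>
    obtain ⟨W, H, f, s, y, t, p, hy, ht, hH, hp, hpb, hl, he, hdeg, hs⟩ := ih
    have hnil : ¬ p.Nil := by rw [← length_eq_zero_iff]; omega
    let i := H.addPendantEmbedding s
    have := hH.1
    have hadj : (H.addPendant s).Adj none (i.toHom s) := (addPendant_adj_none H s).2 rfl
    refine ⟨Option W, H.addPendant s, f.trans i, none, i.toHom y, i.toHom t,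
      cons hadj (p.map i.toHom), by rw [← hy]; rfl, by rw [← ht]; rfl,
      inGA_addPendant_of_isBridge hH (p.adj_snd hnil) (hpb _ (p.mk_start_snd_mem_edges hnil)),
      ?_, ?_, ?_, ?_, ?_, ?_⟩
    · rw [cons_isPath_iff]
      refine ⟨hp.map i.injective, ?_⟩
      rw [Walk.support_map, List.mem_map]
      rintro ⟨z, -, hz⟩
      exact Option.some_ne_none _ hz
    · intro e he
      simp only [edges_cons, edges_map, List.mem_cons, List.mem_map] at he
      rcases he with rfl | ⟨e, he, rfl⟩
      · exact isBridge_addPendant_none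
      · exact isBridge_addPendant_map (p.edges_subset_edgeSet he) (hpb e he)
    · simp [hl]
    · simp only [edges_cons, edges_map]
      exact List.mem_cons_of_mem _ (List.mem_map.2 ⟨_, he, rfl⟩)
    · intro x hx h1 h2
      simp only [support_cons, Walk.support_map, List.mem_cons, List.mem_map] at hx
      rcases hx with rfl | ⟨x, hx, rfl⟩
      · rw [deg_addPendant_none]
        omega
      · have h1' : x ≠ y := fun h => h1 (by rw [h])
        have h2' : x ≠ t := fun h => h2 (by rw [h])
        change deg (H.addPendant s) (some x) ≤ 2
        by_cases hxs : x = s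
        · subst hxs
          rw [deg_addPendant_self]
          have := (hs h1').1
          omega
        · rw [deg_addPendant_of_ne hxs]
          exact hdeg x hx h1' h2'
    · intro
      rw [deg_addPendant_none]
      refine ⟨le_rfl, ?_⟩
      rintro ⟨z, hz⟩
      exact Option.some_ne_none _ hz

/-- A bridge can be closed to a cycle of any prescribed length in `A`. -/
theorem exists_isCycle_of_isBridge (hG : inGA A G) {u v : V} (huv : G.Adj u v)
    (hb : G.IsBridge s(u, v)) {a : ℕ} (ha : a ∈ A) (ha3 : 3 ≤ a) :
    ∃ (W : Type) (H : SimpleGraph W) (f : G ↪g H), inGA A H ∧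
      ∃ (w : W) (c : H.Walk w w), c.IsCycle ∧ c.length = a ∧ s(f u, f v) ∈ c.edges := by
  obtain ⟨W, H, f, s, y, t, p, hy, ht, hH, hp, hpb, hl, he, hdeg, hs⟩ :=
    exists_bridge_path hG huv hb (a - 2)
  have hfin := hH.1
  have hnadj : ¬ H.Adj s t := by
    intro h
    have := hp.eq_of_forall_isBridge hpb (q := cons h nil) (by simpa using h.ne)
    rw [← this] at hl
    simp at hl
    omega
  have hsy : s ≠ y := by
    rintro rfl
    exact hnadj (p.adj_of_mem_edges he)
  obtain ⟨hs1, hsr⟩ := hs hsy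
  have hne : s ≠ t := fun h => hsr ⟨v, ht.trans h.symm⟩
  let X := H ⊔ edge s t
  have hX : inGA A X := by
    refine inGA_sup_edge hH hp hpb (by rwa [hl, show a - 2 + 1 + 1 = a by omega]) (by omega) ?_
    refine le_trans (Set.ncard_le_ncard (t := {y, t}) ?_ (Set.toFinite _))
      (Set.ncard_insert_le _ _ |>.trans (by simp))
    rintro x ⟨hx, hx2⟩
    by_contra hn
    simp only [Set.mem_insert_iff, Set.mem_singleton_iff, not_or] at hn
    by_cases hxs : x = s
    · subst hxs
      have h1 := deg_sup_edge_le (H := H) x t x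
      omega
    · rw [deg_sup_edge_of_ne hxs hn.2] at hx2
      exact absurd (hdeg x hx hn.1 hn.2) (by omega)
  have hadj : ∀ {x z}, X.Adj (f x) (f z) ↔ G.Adj x z := by
    intro x z
    have hx : f x ≠ s := fun h => hsr ⟨x, h⟩
    have hz : f z ≠ s := fun h => hsr ⟨z, h⟩
    simp [X, edge_adj, hx, hz]
  have hle : H ≤ X := le_sup_left
  have hts : X.Adj t s := by simp [X, edge_adj, hne.symm]
  refine ⟨W, X, ⟨f.toEmbedding, hadj⟩, hX, t, cons hts (p.mapLe hle), ?_, ?_, ?_⟩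
  · rw [cons_isCycle_iff]
    refine ⟨hp.mapLe hle, fun h => hnadj (p.adj_of_mem_edges ?_)⟩
    simpa [Sym2.eq_swap] using h
  · simp [hl]
    omega
  · change s(f u, f v) ∈ _
    rw [hy, ht]
    simp [he]

/-- Distinct vertices of a cycle `D` of a graph in the class are separated by the edges of `D`. -/
theorem not_reachable_deleteEdges_of_isCycle (hG : inGA A G) {v u y : V} {D : G.Walk v v}
    (hD : D.IsCycle) (hu : u ∈ D.support) (hy : y ∈ D.support) (huy : u ≠ y) :
    ¬ (G.deleteEdges {e | e ∈ D.edges}).Reachable u y := by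
  classical
  intro hr
  let E := D.rotate u hu
  have hE : E.IsCycle := hD.rotate hu
  have hEe : ∀ e, e ∈ E.edges ↔ e ∈ D.edges := fun e => (D.rotate_edges u hu).mem_iff
  have hyE : y ∈ E.support := (mem_support_rotate_iff ..).2 hy
  have hdis := hE.isTrail.disjoint_edges_takeUntil_dropUntil hyE
  have hedges : ∀ e, e ∈ E.edges ↔
      e ∈ (E.takeUntil y hyE).edges ∨ e ∈ (E.dropUntil y hyE).edges := by
    intro e
    rw [← List.mem_append, ← edges_append, E.take_spec hyE]
  have htn : (E.takeUntil y hyE).IsTrail := hE.isTrail.takeUntil hyE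
  generalize E.takeUntil y hyE = p at *
  generalize E.dropUntil y hyE = q at *
  have hqn : ¬ q.Nil := fun h => huy h.eq.symm
  let K := G.deleteEdges {e | e ∈ q.edges}
  cases p with
  | nil => exact huy rfl
  | @cons _ x _ hux p =>
    have hKadj : K.Adj u x := by
      rw [deleteEdges_adj]
      exact ⟨hux, fun h => hdis (by simp) h⟩
    have hnb : ¬ K.IsBridge s(u, x) := by
      rw [isBridge_iff, not_not]
      have h1 : (K.deleteEdges {s(u, x)}).Reachable u y := by
        refine hr.mono fun a b hab => ?_
        simp only [K, deleteEdges_adj, Set.mem_ofPred_eq, Set.mem_singleton_iff] at hab ⊢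
        refine ⟨⟨hab.1, fun h => hab.2 ?_⟩, fun h => hab.2 ?_⟩
        · exact (hEe _).1 ((hedges _).2 (Or.inr h))
        · exact (hEe _).1 ((hedges _).2 (Or.inl (by simp [h])))
      refine h1.trans (Reachable.symm ⟨p.transfer _ fun e he => ?_⟩)
      simp only [K, edgeSet_deleteEdges]
      refine ⟨⟨p.edges_subset_edgeSet he, fun h => hdis (by simp [he]) h⟩, ?_⟩
      rintro rfl
      exact ((isTrail_cons hux p).1 htn).2 he
    rw [isBridge_iff_forall_cycle_notMem (show s(u, x) ∈ K.edgeSet from hKadj)] at hnb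
    push Not at hnb
    obtain ⟨w, c, hc, hce⟩ := hnb
    have hKG : K ≤ G := deleteEdges_le _
    have key := hG.2.2.1 _ _ (c.mapLe hKG) E (hc.mapLe hKG) hE
      ⟨s(u, x), by simpa using hce, (hedges _).2 (Or.inl (by simp))⟩
    have h2 := (key s(y, q.snd)).2 ((hedges _).2 (Or.inr (q.mk_start_snd_mem_edges hqn)))
    rw [edges_mapLe_eq_edges] at h2
    have h3 := c.adj_of_mem_edges h2
    rw [deleteEdges_adj] at h3
    exact h3.2 (q.mk_start_snd_mem_edges hqn)

/-- If every edge lies on a cycle, some cycle has all its branch vertices equal. -/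
theorem exists_isCycle_branch_subsingleton (hG : inGA A G) (hedge : ∃ v w, G.Adj v w)
    (hnb : ∀ u v, G.Adj u v → ¬ G.IsBridge s(u, v)) :
    ∃ (v : V) (D : G.Walk v v), D.IsCycle ∧ ∃ u ∈ D.support,
      ∀ y ∈ D.support, 2 < deg G y → y = u := by
  classical
  have hfin := hG.1
  have hcyc : ∀ u v, G.Adj u v → ∃ (w : V) (c : G.Walk w w), c.IsCycle ∧ s(u, v) ∈ c.edges := by
    intro u v h
    have := hnb u v h
    rw [isBridge_iff_forall_cycle_notMem h] at this
    push Not at this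
    exact this
  by_contra! hcon
  have descent : ∀ (n : ℕ) (v u : V) (C : G.Walk v v), C.IsCycle → u ∈ C.support → 2 < deg G u →
      {z | (G.deleteEdges {e | e ∈ C.edges}).Reachable u z}.ncard = n → False := by
    intro n
    induction n using Nat.strong_induction_on with
    | _ n ih =>
      intro v u C hC hu hdu hn
      obtain ⟨w, huw, hwC⟩ := hC.exists_adj_notMem_edges hu hdu
      obtain ⟨x, D, hD, hDe⟩ := hcyc u w huw
      have huD := D.fst_mem_support_of_mem_edges hDe
      obtain ⟨y, hyD, hdy, hyu⟩ := hcon x D hD u huD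
      have hdisj : ∀ e, e ∈ C.edges → e ∉ D.edges := fun e heC heD =>
        hwC ((hG.2.2.1 _ _ C D hC hD ⟨e, heC, heD⟩ _).2 hDe)
      have hsep := not_reachable_deleteEdges_of_isCycle hG hD hyD huD hyu
      refine ih _ ?_ x y D hD hyD hdy rfl
      rw [← hn]
      refine Set.ncard_lt_ncard ⟨fun z hz => ?_, fun h => hsep (h (Reachable.refl u))⟩
        (Set.toFinite _)
      have huy : (G.deleteEdges {e | e ∈ C.edges}).Reachable u y := by
        have hyR : y ∈ (D.rotate u huD).support := (mem_support_rotate_iff ..).2 hyD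
        refine ⟨((D.rotate u huD).takeUntil y hyR).toDeleteEdges _ fun e he heC => hdisj e heC ?_⟩
        exact (D.rotate_edges u huD).mem_iff.1 (edges_takeUntil_subset_edges _ hyR he)
      obtain ⟨q⟩ := hz
      refine huy.trans ⟨q.transfer _ fun e he => ?_⟩
      have heG := q.edges_subset_edgeSet he
      rw [edgeSet_deleteEdges] at heG ⊢
      refine ⟨heG.1, fun heC => hsep ?_⟩
      induction e with
      | h a b =>
        refine Reachable.trans ⟨q.takeUntil a (q.fst_mem_support_of_mem_edges he)⟩ ?_
        have haC := C.fst_mem_support_of_mem_edges heC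
        have haR : a ∈ (C.rotate u hu).support := (mem_support_rotate_iff ..).2 haC
        refine Reachable.symm
          ⟨((C.rotate u hu).takeUntil a haR).toDeleteEdges _ fun e he heD => hdisj e ?_ heD⟩
        exact (C.rotate_edges u hu).mem_iff.1 (edges_takeUntil_subset_edges _ haR he)
  obtain ⟨v, w, hvw⟩ := hedge
  obtain ⟨x, C, hC, -⟩ := hcyc v w hvw
  obtain ⟨y, hy, hdy, -⟩ := hcon x C hC x C.start_mem_support
  exact descent _ x y C hC hy hdy rfl

/-- A cycle has two further vertices besides any given one. -/
theorem Walk.IsCycle.exists_ne_ne {v u : V} {c : G.Walk v v} (hc : c.IsCycle)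
    (hu : u ∈ c.support) :
    ∃ x ∈ c.support, ∃ y ∈ c.support, x ≠ u ∧ y ≠ u ∧ x ≠ y := by
  obtain ⟨x, y, hxy, h⟩ := Set.ncard_eq_two.1 (hc.ncard_incident hu)
  have hx : s(u, x) ∈ c.edges := by
    have : x ∈ {w | s(u, w) ∈ c.edges} := by rw [h]; simp
    exact this
  have hy : s(u, y) ∈ c.edges := by
    have : y ∈ {w | s(u, w) ∈ c.edges} := by rw [h]; simp
    exact this
  exact ⟨x, c.snd_mem_support_of_mem_edges hx, y, c.snd_mem_support_of_mem_edges hy,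
    (c.adj_of_mem_edges hx).ne', (c.adj_of_mem_edges hy).ne', hxy⟩

end SimpleGraph

open SimpleGraph Walk

/-- The class `𝒢_A` fails CAP in a strong form: no non-discrete `G ∈ 𝒢_A` has an
extension `G' ∈ 𝒢_A` witnessing cofinal amalgamation. -/
theorem stmt11 (A : Set ℕ) (hA : A ⊆ {n | 3 ≤ n}) (hA2 : A.Nontrivial)
    {V V' : Type} (G : SimpleGraph V) (G' : SimpleGraph V')
    (hG : inGA A G) (hedge : ∃ v w : V, G.Adj v w) (hG' : inGA A G')
    (ι : G ↪g G') :
    ∃ (VX VY : Type) (X : SimpleGraph VX) (Y : SimpleGraph VY)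
      (f : G' ↪g X) (g : G' ↪g Y),
      inGA A X ∧ inGA A Y ∧
      ¬ ∃ (VW : Type) (W : SimpleGraph VW) (f' : X ↪g W) (g' : Y ↪g W),
          inGA A W ∧ ∀ x, f' (f x) = g' (g x) := by
  have hfin := hG'.1
  by_cases hbr : ∃ u v, G'.Adj u v ∧ G'.IsBridge s(u, v)
  · obtain ⟨u, v, huv, hb⟩ := hbr
    obtain ⟨a, ha, b, hb', hab⟩ := hA2
    obtain ⟨VX, X, f, hX, x, c, hc, hcl, hce⟩ := exists_isCycle_of_isBridge hG' huv hb ha (hA ha)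
    obtain ⟨VY, Y, g, hY, y, d, hd, hdl, hde⟩ := exists_isCycle_of_isBridge hG' huv hb hb' (hA hb')
    refine ⟨VX, VY, X, Y, f, g, hX, hY, ?_⟩
    rintro ⟨VW, W, f', g', hW, h⟩
    have hc' : (c.map f'.toHom).IsCycle := hc.map f'.injective
    have hd' : (d.map g'.toHom).IsCycle := hd.map g'.injective
    have key := hW.2.2.1 _ _ _ _ hc' hd' ⟨s(f' (f u), f' (f v)), ?_, ?_⟩
    · have hperm := (List.perm_ext_iff_of_nodup hc'.isTrail.edges_nodup
        hd'.isTrail.edges_nodup).2 key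
      have := hperm.length_eq
      simp [hcl, hdl] at this
      exact hab this
    · rw [edges_map]
      exact List.mem_map.2 ⟨_, hce, rfl⟩
    · rw [edges_map, h, h]
      exact List.mem_map.2 ⟨_, hde, rfl⟩
  · push Not at hbr
    have hedge' : ∃ v w, G'.Adj v w := by
      obtain ⟨v, w, h⟩ := hedge
      exact ⟨ι v, ι w, ι.map_adj_iff.2 h⟩
    obtain ⟨a, D, hD, u, hu, hsub⟩ := exists_isCycle_branch_subsingleton hG' hedge' hbr
    obtain ⟨v, hv, w, hw, hvu, hwu, hvw⟩ := hD.exists_ne_ne hu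
    have hbranch : {z | z ∈ D.support ∧ 2 < deg G' z} ⊆ {u} := fun z hz => hsub z hz.1 hz.2
    have hpair : ∀ {T : Type} (b c : T), ({b, c} : Set T).ncard ≤ 2 := fun b c =>
      (Set.ncard_insert_le _ _).trans (by simp)
    have hinsert : ∀ z, (insert z {z | z ∈ D.support ∧ 2 < deg G' z}).ncard ≤ 2 := fun z =>
      (Set.ncard_le_ncard (Set.insert_subset_insert hbranch) (Set.toFinite _)).trans (hpair z u)
    let P := G'.addPendant u
    let i : G' ↪g P := G'.addPendantEmbedding u
    have hP : inGA A P := inGA_addPendant_of_isCycle hG' hD hu (hinsert u)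
    have hDP : (D.map i.toHom).IsCycle := hD.map i.injective
    have hvP : i v ∈ (D.map i.toHom).support := by
      rw [Walk.support_map]
      exact List.mem_map.2 ⟨v, hv, rfl⟩
    have hX : inGA A (P.addPendant (i v)) := by
      refine inGA_addPendant_of_isCycle hP hDP hvP ?_
      refine (Set.ncard_le_ncard (t := {i v, i u}) (Set.insert_subset_insert ?_)
        (Set.toFinite _)).trans (hpair _ _)
      rintro z ⟨hz, hz2⟩
      rw [Walk.support_map] at hz
      obtain ⟨z, hzD, rfl⟩ := List.mem_map.1 hz
      by_cases hzu : z = u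
      · rw [hzu]
        rfl
      · exact absurd (hsub z hzD ((deg_addPendant_of_ne hzu) ▸ hz2)) hzu
    have hY : inGA A (G'.addPendant w) := inGA_addPendant_of_isCycle hG' hD hw (hinsert w)
    let j := P.addPendantEmbedding (i v)
    let k := G'.addPendantEmbedding w
    refine ⟨_, _, P.addPendant (i v), G'.addPendant w, i.trans j, k, hX, hY, ?_⟩
    rintro ⟨VW, W, f', g', hW, h⟩
    have hWfin := hW.1
    have hPfin := hP.1
    have hXfin := hX.1
    have hYfin := hY.1
    have hdw : 2 < deg W (g' (k w)) := by
      refine lt_of_lt_of_le ?_ (deg_le_deg_map g' _)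
      change 2 < deg (G'.addPendant w) (some w)
      rw [deg_addPendant_self]
      have := hD.two_le_deg hw
      omega
    have hdu : 2 < deg W (f' (j (i u))) := by
      refine lt_of_lt_of_le ?_ (deg_le_deg_map f' _)
      refine lt_of_lt_of_le ?_ (deg_le_deg_map j _)
      change 2 < deg (G'.addPendant u) (some u)
      rw [deg_addPendant_self]
      have := hD.two_le_deg hu
      omega
    have hdv : 2 < deg W (f' (j (i v))) := by
      refine lt_of_lt_of_le ?_ (deg_le_deg_map f' _)
      change 2 < deg (P.addPendant (i v)) (some (i v))
      rw [deg_addPendant_self]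
      have := hDP.two_le_deg hvP
      omega
    let F := f'.comp (i.trans j)
    have hF : ∀ z, F z = f' (j (i z)) := fun z => rfl
    have hbd := hW.2.2.2 _ (D.map F.toHom) (hD.map F.injective)
    have hmem : ∀ z ∈ D.support, F z ∈ (D.map F.toHom).support := fun z hz => by
      rw [Walk.support_map]
      exact List.mem_map.2 ⟨z, hz, rfl⟩
    have h3 : ({F u, F v, F w} : Set VW).ncard = 3 :=
      Set.ncard_eq_three.2 ⟨F u, F v, F w, F.injective.ne hvu.symm, F.injective.ne hwu.symm,
        F.injective.ne hvw, rfl⟩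
    have hss : ({F u, F v, F w} : Set VW) ⊆
        {z | z ∈ (D.map F.toHom).support ∧ 2 < deg W z} := by
      rintro z (rfl | rfl | rfl)
      · exact ⟨hmem u hu, hdu⟩
      · exact ⟨hmem v hv, hdv⟩
      · refine ⟨hmem w hw, ?_⟩
        rw [hF]
        exact (h w) ▸ hdw
    have := Set.ncard_le_ncard hss (Set.toFinite _)
    omega
end

section
/- The class 𝒢_A has the weak amalgamation property: for every G ∈ 𝒢_A there exists H' ∈ 𝒢_A containing G as an induced subgraph, such that for all X, Y ∈ 𝒢_A and all graph embeddings f : H' → X and g : H' → Y, there exist W ∈ 𝒢_A and graph embeddings f' : X → W and g' : Y → W with f' ∘ f and g' ∘ g agreeing on G. -/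
namespace WeakAmalgamation

open SimpleGraph

variable {V VX VY VW S : Type}

section Cycles

variable {G : SimpleGraph V}

/-- A path between two vertices of a set `K` that can only be left through the vertex `s`
stays inside `K`. -/
theorem path_support_subset {K : Set V} {s : V}
    (hK : ∀ u ∈ K, ∀ w ∉ K, G.Adj u w → u = s) {u v : V} (p : G.Walk u v) (hp : p.IsPath)
    (hv : v ∈ K) : (u ∈ K → ∀ w ∈ p.support, w ∈ K) ∧ (u ∉ K → s ∈ p.support) := by
  induction p with
  | nil => simp_all
  | @cons u w v h p ih =>
    rw [Walk.cons_isPath_iff] at hp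
    obtain ⟨ih₁, ih₂⟩ := ih hp.1 hv
    by_cases hw : w ∈ K
    · refine ⟨fun hu z hz => ?_, fun hu => ?_⟩
      · rcases List.mem_cons.1 (by simpa using hz) with rfl | hz
        · exact hu
        · exact ih₁ hw z hz
      · rw [← hK w hw u hu h.symm]
        simp
    · refine ⟨fun hu => ?_, fun hu => ?_⟩
      · exact absurd (hK u hu w hw h ▸ ih₂ hw) hp.2
      · simp [ih₂ hw]

/-- A cycle with two vertices in a set `K` that can only be left through the vertex `s`
stays inside `K`. -/
theorem cycle_support_subset {K : Set V} {s : V}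
    (hK : ∀ u ∈ K, ∀ w ∉ K, G.Adj u w → u = s) {x : V} {c : G.Walk x x} (hc : c.IsCycle)
    {u v : V} (huv : u ≠ v) (hu : u ∈ c.support) (hv : v ∈ c.support) (huK : u ∈ K)
    (hvK : v ∈ K) : ∀ w ∈ c.support, w ∈ K := by
  classical
  have hrot : ∀ w, w ∈ c.support ↔ w ∈ (c.rotate u hu).support := fun w => by
    rw [Walk.mem_support_rotate_iff]
  have hc' := hc.rotate hu
  simp only [hrot] at hv ⊢
  generalize c.rotate u hu = d at *
  cases d with
  | nil => simp at hc'
  | @cons _ w _ h p =>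
    rw [Walk.cons_isCycle_iff] at hc'
    have hvp : v ∈ p.support := by
      rcases List.mem_cons.1 (by simpa using hv) with rfl | h
      · exact absurd rfl huv
      · exact h
    by_cases hw : w ∈ K
    · intro z hz
      rcases List.mem_cons.1 (by simpa using hz) with rfl | hz
      · exact huK
      · exact (path_support_subset hK p hc'.1 huK).1 hw z hz
    · have hs := hK u huK w hw h
      subst hs
      exact absurd ((path_support_subset hK _ (hc'.1.takeUntil hvp) hvK).2 hw)
        (Walk.endpoint_notMem_support_takeUntil hc'.1 hvp huv)

/-- Every vertex of a cycle is incident to two distinct edges of the cycle. -/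
theorem exists_two_edges {x : V} {c : G.Walk x x} (hc : c.IsCycle) {u : V}
    (hu : u ∈ c.support) : ∃ a b, a ≠ b ∧ s(u, a) ∈ c.edges ∧ s(u, b) ∈ c.edges := by
  obtain ⟨a, b, hab, h⟩ := Set.ncard_eq_two.1 (hc.ncard_neighborSet_toSubgraph_eq_two hu)
  have key : ∀ w ∈ ({a, b} : Set V), s(u, w) ∈ c.edges := fun w hw => by
    rw [← h] at hw
    exact Walk.mem_edges_toSubgraph c |>.1 hw
  exact ⟨a, b, hab, key a (by simp), key b (by simp)⟩

theorem exists_edge_ne {x : V} {c : G.Walk x x} (hc : c.IsCycle) {u : V}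
    (hu : u ∈ c.support) (v : V) : ∃ a, a ≠ v ∧ s(u, a) ∈ c.edges := by
  obtain ⟨a, b, hab, ha, hb⟩ := exists_two_edges hc hu
  by_cases h : a = v
  · exact ⟨b, fun h' => hab (h.trans h'.symm), hb⟩
  · exact ⟨a, h, ha⟩

/-- At a vertex of degree at most two, a cycle uses all edges. -/
theorem mem_edges_of_deg_le [Finite V] {x : V} {c : G.Walk x x} (hc : c.IsCycle) {u w : V}
    (hu : u ∈ c.support) (hd : deg G u ≤ 2) (h : G.Adj u w) : s(u, w) ∈ c.edges := by
  obtain ⟨a, b, hab, ha, hb⟩ := exists_two_edges hc hu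
  have hsub : ({a, b} : Set V) ⊆ {w | G.Adj u w} := by
    rintro z (rfl | rfl)
    · exact c.adj_of_mem_edges ha
    · exact c.adj_of_mem_edges hb
  have heq := Set.eq_of_subset_of_ncard_le hsub (by rw [Set.ncard_pair hab]; exact hd)
    (Set.toFinite _)
  have hw : w ∈ ({a, b} : Set V) := heq ▸ h
  rcases hw with rfl | rfl <;> assumption

theorem two_lt_deg [Finite V] {u a b w : V} (hab : a ≠ b) (ha : w ≠ a) (hb : w ≠ b)
    (h₁ : G.Adj u a) (h₂ : G.Adj u b) (h₃ : G.Adj u w) : 2 < deg G u := by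
  have h := Set.ncard_le_ncard (s := {w, a, b}) (t := {w | G.Adj u w})
    (by rintro z (rfl | rfl | rfl) <;> assumption) (Set.toFinite _)
  rw [Set.ncard_insert_of_notMem (by simp [ha, hb]), Set.ncard_pair hab] at h
  exact h

theorem mem_support_of_edges_iff {x y : V} {c : G.Walk x x} {d : G.Walk y y} (hc : c.IsCycle)
    (hd : d.IsCycle) (h : ∀ e, e ∈ c.edges ↔ e ∈ d.edges) (u : V) :
    u ∈ c.support ↔ u ∈ d.support := by
  rw [Walk.mem_support_iff_exists_mem_edges_of_not_nil hc.not_nil,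
    Walk.mem_support_iff_exists_mem_edges_of_not_nil hd.not_nil]
  simp [h]

/-- The edge `e` lies on some cycle of `G`. -/
def OnCycle (G : SimpleGraph V) (e : Sym2 V) : Prop :=
  ∃ (v : V) (c : G.Walk v v), c.IsCycle ∧ e ∈ c.edges

theorem OnCycle.map {G : SimpleGraph VX} {W : SimpleGraph VW} (f : G ↪g W) {u v : VX}
    (h : OnCycle G s(u, v)) : OnCycle W s(f u, f v) := by
  obtain ⟨x, c, hc, he⟩ := h
  refine ⟨_, c.map f.toHom, hc.map f.injective, ?_⟩
  rw [Walk.edges_map]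
  exact List.mem_map.2 ⟨_, he, rfl⟩

end Cycles

section Embeddings

variable {X : SimpleGraph VX} {W : SimpleGraph VW}

theorem exists_walk_map_eq (f : X ↪g W) {a b : VW} (p : W.Walk a b)
    (hp : ∀ w ∈ p.support, w ∈ Set.range f) {x y : VX} (hx : f x = a) (hy : f y = b) :
    ∃ q : X.Walk x y, (q.map f.toHom).copy hx hy = p := by
  induction p generalizing x with
  | nil =>
    subst hx
    obtain rfl := f.injective hy
    exact ⟨Walk.nil, rfl⟩
  | @cons a w b h p ih =>
    obtain ⟨z, rfl⟩ := hp w (by simp)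
    obtain ⟨q, hq⟩ := ih (fun w hw => hp w (by simp [hw])) rfl hy
    subst hx
    refine ⟨Walk.cons (f.map_adj_iff.1 h) q, ?_⟩
    subst hy hq
    rfl

/-- A cycle supported in the image of an embedding comes from a cycle of the source. -/
theorem exists_cycle_map_eq (f : X ↪g W) {a : VW} {c : W.Walk a a} (hc : c.IsCycle)
    (hr : ∀ w ∈ c.support, w ∈ Set.range f) :
    ∃ (x : VX) (q : X.Walk x x), q.IsCycle ∧ q.length = c.length ∧
      (∀ u, f u ∈ c.support ↔ u ∈ q.support) ∧
      (∀ e, e ∈ c.edges ↔ ∃ e' ∈ q.edges, e'.map f = e) := by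
  obtain ⟨x, rfl⟩ := hr a (by simp)
  obtain ⟨q, rfl⟩ := exists_walk_map_eq f c hr rfl rfl
  refine ⟨x, q, Walk.IsCycle.of_map (f := f.toHom) hc, by simp, fun u => ?_, fun e => ?_⟩
  · simp only [Walk.copy_rfl_rfl, Walk.support_map, List.mem_map]
    exact ⟨fun ⟨v, hv, h⟩ => f.injective h ▸ hv, fun h => ⟨u, h, rfl⟩⟩
  · simp only [Walk.copy_rfl_rfl, Walk.edges_map, List.mem_map]
    rfl

theorem deg_le_deg_map [Finite VW] (f : X ↪g W) (x : VX) : deg X x ≤ deg W (f x) := by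
  rw [deg, ← Set.ncard_image_of_injective _ f.injective]
  refine Set.ncard_le_ncard ?_ (Set.toFinite _)
  rintro _ ⟨y, hy, rfl⟩
  exact f.map_adj_iff.2 hy

theorem deg_map_le_deg [Finite VX] (f : X ↪g W) (x : VX)
    (h : ∀ w, W.Adj (f x) w → w ∈ Set.range f) : deg W (f x) ≤ deg X x := by
  rw [deg, deg, ← Set.ncard_image_of_injective {w | X.Adj x w} f.injective]
  refine Set.ncard_le_ncard ?_ (Set.toFinite _)
  intro w hw
  obtain ⟨y, rfl⟩ := h w hw
  exact ⟨y, f.map_adj_iff.1 hw, rfl⟩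

end Embeddings

section Gluing

/-- The subgraph of `X` of all edges that do not join two vertices of `T`. -/
def offGraph (X : SimpleGraph VX) (T : Set VX) : SimpleGraph VX where
  Adj x y := X.Adj x y ∧ ¬(x ∈ T ∧ y ∈ T)
  symm := ⟨fun _ _ h => ⟨h.1.symm, fun h' => h.2 h'.symm⟩⟩
  loopless := ⟨fun _ h => h.1.ne rfl⟩

theorem offGraph_le (X : SimpleGraph VX) (T : Set VX) : offGraph X T ≤ X := fun _ _ h => h.1

/-- Distinct vertices of `T` are joined in `X` only through edges inside `T`. -/
def Separated (X : SimpleGraph VX) (T : Set VX) : Prop :=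
  ∀ s ∈ T, ∀ t ∈ T, (offGraph X T).Reachable s t → s = t

/-- `W` is obtained by gluing `X` and `Y` along their common induced subgraph `K`. -/
structure IsGlue {K : SimpleGraph S} {X : SimpleGraph VX} {Y : SimpleGraph VY}
    {W : SimpleGraph VW} (i : K ↪g X) (j : K ↪g Y) (f : X ↪g W) (g : Y ↪g W) : Prop where
  comm : ∀ s, f (i s) = g (j s)
  cover : ∀ w, w ∈ Set.range f ∨ w ∈ Set.range g
  inter : ∀ x y, f x = g y → ∃ s, i s = x ∧ j s = y
  edge : ∀ w w', W.Adj w w' → (∃ x x', X.Adj x x' ∧ f x = w ∧ f x' = w') ∨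
    ∃ y y', Y.Adj y y' ∧ g y = w ∧ g y' = w'

theorem exists_isGlue {K : SimpleGraph S} {X : SimpleGraph VX} {Y : SimpleGraph VY}
    (i : K ↪g X) (j : K ↪g Y) :
    ∃ (VW : Type) (W : SimpleGraph VW) (f : X ↪g W) (g : Y ↪g W), IsGlue i j f g := by
  classical
  let F : VX ↪ VX ⊕ {y // y ∉ Set.range j} := ⟨Sum.inl, Sum.inl_injective⟩
  let G₀ : VY → VX ⊕ {y // y ∉ Set.range j} := fun y =>
    if h : y ∈ Set.range j then Sum.inl (i h.choose) else Sum.inr ⟨y, h⟩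
  have hG₁ : ∀ s, G₀ (j s) = F (i s) := fun s => by
    have h : j s ∈ Set.range j := ⟨s, rfl⟩
    have h' : h.choose = s := j.injective h.choose_spec
    simp only [G₀, dif_pos h, h']
    rfl
  have hG₂ : ∀ y (h : y ∉ Set.range j), G₀ y = Sum.inr ⟨y, h⟩ := fun y h => dif_neg h
  have hG₃ : ∀ x y, F x = G₀ y → ∃ s, i s = x ∧ j s = y := fun x y h => by
    by_cases hy : y ∈ Set.range j
    · obtain ⟨s, rfl⟩ := hy
      rw [hG₁] at h
      exact ⟨s, (F.injective h).symm, rfl⟩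
    · rw [hG₂ y hy] at h
      cases h
  have hinj : Function.Injective G₀ := fun y y' h => by
    by_cases hy : y ∈ Set.range j
    · obtain ⟨s, rfl⟩ := hy
      rw [hG₁] at h
      obtain ⟨t, ht, rfl⟩ := hG₃ _ _ h
      rw [i.injective ht]
    · by_cases hy' : y' ∈ Set.range j
      · obtain ⟨s, rfl⟩ := hy'
        rw [hG₁] at h
        obtain ⟨t, ht, rfl⟩ := hG₃ _ _ h.symm
        rw [i.injective ht]
      · rw [hG₂ y hy, hG₂ y' hy'] at h
        simpa using h
  let G : VY ↪ VX ⊕ {y // y ∉ Set.range j} := ⟨G₀, hinj⟩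
  have hadj : ∀ s t, X.Adj (i s) (i t) ↔ Y.Adj (j s) (j t) := fun s t => by
    rw [i.map_adj_iff, j.map_adj_iff]
  refine ⟨_, X.map F ⊔ Y.map G, ⟨F, ?_⟩, ⟨G, ?_⟩, ?_, ?_, ?_, ?_⟩
  · intro a b
    refine ⟨?_, fun h => Or.inl ⟨h.ne |> F.injective.ne, a, b, h, rfl, rfl⟩⟩
    rintro (⟨-, a', b', h, ha, hb⟩ | ⟨-, a', b', h, ha, hb⟩)
    · rwa [← F.injective ha, ← F.injective hb]
    · obtain ⟨s, rfl, rfl⟩ := hG₃ _ _ ha.symm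
      obtain ⟨t, rfl, rfl⟩ := hG₃ _ _ hb.symm
      exact (hadj s t).2 h
  · intro a b
    refine ⟨?_, fun h => Or.inr ⟨h.ne |> G.injective.ne, a, b, h, rfl, rfl⟩⟩
    rintro (⟨-, a', b', h, ha, hb⟩ | ⟨-, a', b', h, ha, hb⟩)
    · obtain ⟨s, rfl, rfl⟩ := hG₃ _ _ ha
      obtain ⟨t, rfl, rfl⟩ := hG₃ _ _ hb
      exact (hadj s t).1 h
    · rwa [← G.injective ha, ← G.injective hb]
  · exact fun s => (hG₁ s).symm
  · rintro (x | ⟨y, hy⟩)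
    · exact Or.inl ⟨x, rfl⟩
    · exact Or.inr ⟨y, hG₂ y hy⟩
  · exact hG₃
  · rintro w w' (⟨-, a', b', h, ha, hb⟩ | ⟨-, a', b', h, ha, hb⟩)
    · exact Or.inl ⟨a', b', h, ha, hb⟩
    · exact Or.inr ⟨a', b', h, ha, hb⟩

namespace IsGlue

variable {K : SimpleGraph S} {X : SimpleGraph VX} {Y : SimpleGraph VY}
    {W : SimpleGraph VW} {i : K ↪g X} {j : K ↪g Y} {f : X ↪g W} {g : Y ↪g W}

theorem symm (h : IsGlue i j f g) : IsGlue j i g f where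
  comm s := (h.comm s).symm
  cover w := (h.cover w).symm
  inter x y hxy := (h.inter y x hxy.symm).imp fun _ => And.symm
  edge w w' hw := (h.edge w w' hw).symm

theorem finite (h : IsGlue i j f g) [Finite VX] [Finite VY] : Finite VW := by
  have : Set.range f ∪ Set.range g = Set.univ := Set.eq_univ_of_forall h.cover
  exact Set.finite_univ_iff.1 (this ▸ (Set.finite_range f).union (Set.finite_range g))

/-- Vertices outside the glued part acquire no new neighbors. -/
theorem adj_mem_range (h : IsGlue i j f g) {x : VX} (hx : x ∉ Set.range i) {w : VW}
    (hw : W.Adj (f x) w) : w ∈ Set.range f := by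
  rcases h.edge _ _ hw with ⟨_, x', _, _, rfl⟩ | ⟨y, _, _, hy, _⟩
  · exact ⟨x', rfl⟩
  · obtain ⟨s, hs, -⟩ := h.inter x y hy.symm
    exact absurd ⟨s, hs⟩ hx

/-- If the glued part is separated in `X`, every cycle lies in `X` and meets the glued part in
at most one vertex, or it lies in `Y`. -/
theorem cycle_cases (h : IsGlue i j f g) (hsep : Separated X (Set.range i)) {a : VW}
    {c : W.Walk a a} (hc : c.IsCycle) :
    ((∀ w ∈ c.support, w ∈ Set.range f) ∧
      ∀ s t, f (i s) ∈ c.support → f (i t) ∈ c.support → s = t) ∨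
    ∀ w ∈ c.support, w ∈ Set.range g := by
  by_cases hall : ∀ u v, s(u, v) ∈ c.edges → u ∈ Set.range g
  · refine Or.inr fun w hw => ?_
    obtain ⟨a, b, -, ha, -⟩ := exists_two_edges hc hw
    exact hall _ _ ha
  left
  push Not at hall
  obtain ⟨u, v, huv, hu⟩ := hall
  have huv' := c.adj_of_mem_edges huv
  rcases h.edge u v huv' with ⟨x, y, hxy, rfl, rfl⟩ | ⟨y, _, _, rfl, _⟩
  swap
  · exact absurd ⟨y, rfl⟩ hu
  let Q := offGraph X (Set.range i)
  have hQ : Q.Adj x y := ⟨hxy, fun ⟨⟨s, hs⟩, _⟩ => hu ⟨j s, by rw [← h.comm, hs]⟩⟩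
  let C : Set VW := {w | ∃ z, f z = w ∧ Q.Reachable x z}
  obtain ⟨s₀, hs₀⟩ : ∃ s₀, ∀ t, Q.Reachable x (i t) → f (i t) = s₀ := by
    by_cases hex : ∃ t, Q.Reachable x (i t)
    · obtain ⟨t, ht⟩ := hex
      exact ⟨f (i t), fun t' ht' => by
        rw [hsep (i t') ⟨t', rfl⟩ (i t) ⟨t, rfl⟩ (ht'.symm.trans ht)]⟩
    · exact ⟨f x, fun t ht => absurd ⟨t, ht⟩ hex⟩
  have hC : ∀ u ∈ C, ∀ w ∉ C, W.Adj u w → u = s₀ := by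
    rintro _ ⟨z, rfl, hz⟩ w hw hadj
    by_cases hzi : z ∈ Set.range i
    · obtain ⟨t, rfl⟩ := hzi
      exact hs₀ t hz
    · obtain ⟨z', rfl⟩ := h.adj_mem_range hzi hadj
      refine absurd ⟨z', rfl, hz.trans (Adj.reachable ?_)⟩ hw
      exact ⟨f.map_adj_iff.1 hadj, fun h => hzi h.1⟩
  have hsub := cycle_support_subset hC hc huv'.ne (c.fst_mem_support_of_mem_edges huv)
    (c.snd_mem_support_of_mem_edges huv) ⟨x, rfl, .refl _⟩ ⟨y, rfl, hQ.reachable⟩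
  refine ⟨fun w hw => ?_, fun s t hs ht => ?_⟩
  · obtain ⟨z, rfl, -⟩ := hsub w hw
    exact ⟨z, rfl⟩
  · obtain ⟨z, hz, hz'⟩ := hsub _ hs
    obtain ⟨z₂, hz₂, hz₂'⟩ := hsub _ ht
    rw [f.injective hz] at hz'
    rw [f.injective hz₂] at hz₂'
    exact i.injective (hsep _ ⟨s, rfl⟩ _ ⟨t, rfl⟩ (hz'.symm.trans hz₂'))

/-- Gluing preserves `𝒢_A` as soon as the condition on degrees is preserved. -/
theorem inGA (h : IsGlue i j f g) (hsep : Separated X (Set.range i)) {A : Set ℕ}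
    (hX : inGA A X) (hY : inGA A Y)
    (hdeg : ∀ (v : VW) (c : W.Walk v v), c.IsCycle →
      {u | u ∈ c.support ∧ 2 < deg W u}.ncard ≤ 2) : inGA A W := by
  have := hX.1
  have := hY.1
  have key : ∀ {VZ : Type} {Z : SimpleGraph VZ} (e : Z ↪g W), _root_.inGA A Z →
      ∀ (v v' : VW) (c : W.Walk v v) (c' : W.Walk v' v'), c.IsCycle → c'.IsCycle →
      (∀ w ∈ c.support, w ∈ Set.range e) → (∀ w ∈ c'.support, w ∈ Set.range e) →
      (∃ e, e ∈ c.edges ∧ e ∈ c'.edges) → ∀ e, e ∈ c.edges ↔ e ∈ c'.edges := by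
    rintro VZ Z e hZ v v' c c' hc hc' hr hr' ⟨e₀, he₀, he₀'⟩ e₁
    obtain ⟨x, q, hq, -, -, hqe⟩ := exists_cycle_map_eq e hc hr
    obtain ⟨x', q', hq', -, -, hqe'⟩ := exists_cycle_map_eq e hc' hr'
    obtain ⟨a, ha, ha'⟩ := (hqe _).1 he₀
    obtain ⟨b, hb, hb'⟩ := (hqe' _).1 he₀'
    have hab : a = b := Sym2.map.injective e.injective (ha'.trans hb'.symm)
    simp only [hqe, hqe', hZ.2.2.1 _ _ q q' hq hq' ⟨a, ha, hab ▸ hb⟩]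
  have excl : ∀ (v v' : VW) (c : W.Walk v v) (c' : W.Walk v' v'),
      (∀ w ∈ c.support, w ∈ Set.range f) →
      (∀ s t, f (i s) ∈ c.support → f (i t) ∈ c.support → s = t) →
      (∀ w ∈ c'.support, w ∈ Set.range g) → ¬ ∃ e, e ∈ c.edges ∧ e ∈ c'.edges := by
    rintro v v' c c' hr hs hr' ⟨e, he, he'⟩
    induction e with | _ a b =>
    have hab := c.adj_of_mem_edges he
    have glued : ∀ w, w ∈ c.support → w ∈ c'.support → ∃ s, f (i s) = w := by
      intro w hw hw'
      obtain ⟨x, rfl⟩ := hr w hw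
      obtain ⟨y, hy⟩ := hr' _ hw'
      obtain ⟨s, rfl, -⟩ := h.inter x y hy.symm
      exact ⟨s, rfl⟩
    have ha := c.fst_mem_support_of_mem_edges he
    have hb := c.snd_mem_support_of_mem_edges he
    obtain ⟨s, rfl⟩ := glued a ha (c'.fst_mem_support_of_mem_edges he')
    obtain ⟨t, rfl⟩ := glued b hb (c'.snd_mem_support_of_mem_edges he')
    exact hab.ne (by rw [hs s t ha hb])
  refine ⟨h.finite, fun v c hc => ?_, fun v v' c c' hc hc' he => ?_, hdeg⟩
  · rcases h.cycle_cases hsep hc with ⟨hr, -⟩ | hr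
    · obtain ⟨x, q, hq, hl, -⟩ := exists_cycle_map_eq f hc hr
      exact hl ▸ hX.2.1 x q hq
    · obtain ⟨x, q, hq, hl, -⟩ := exists_cycle_map_eq g hc hr
      exact hl ▸ hY.2.1 x q hq
  · rcases h.cycle_cases hsep hc with ⟨hr, hs⟩ | hr <;>
      rcases h.cycle_cases hsep hc' with ⟨hr', hs'⟩ | hr'
    · exact key f hX v v' c c' hc hc' hr hr' he
    · exact absurd he (excl v v' c c' hr hs hr')
    · exact absurd (he.imp fun _ => And.symm) (excl v' v c' c hr' hs' hr)
    · exact key g hY v v' c c' hc hc' hr hr' he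

end IsGlue

end Gluing

section CycleGraph

theorem deg_cycleGraph {m : ℕ} (v : Fin (m + 3)) : deg (cycleGraph (m + 3)) v = 2 := by
  have h := cycleGraph_degree_three_le (v := v)
  rwa [← card_neighborSet_eq_degree, ← Nat.card_eq_fintype_card, Nat.card_coe_set_eq] at h

theorem cycleGraph_mem_support {m : ℕ} {v : Fin (m + 3)} {c : (cycleGraph (m + 3)).Walk v v}
    (hc : c.IsCycle) (u : Fin (m + 3)) : u ∈ c.support := by
  obtain ⟨p⟩ := cycleGraph_preconnected v u
  have : ∀ {x y : Fin (m + 3)} (p : (cycleGraph (m + 3)).Walk x y), x ∈ c.support →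
      y ∈ c.support := fun p => by
    induction p with
    | nil => exact id
    | cons h p ih =>
      exact fun hx => ih (c.snd_mem_support_of_mem_edges
        (mem_edges_of_deg_le hc hx (deg_cycleGraph _).le h))
  exact this p (by simp)

theorem cycleGraph_mem_edges {m : ℕ} {v : Fin (m + 3)} {c : (cycleGraph (m + 3)).Walk v v}
    (hc : c.IsCycle) {a b : Fin (m + 3)} (h : (cycleGraph (m + 3)).Adj a b) :
    s(a, b) ∈ c.edges :=
  mem_edges_of_deg_le hc (cycleGraph_mem_support hc a) (deg_cycleGraph _).le h

theorem onCycle_cycleGraph {m : ℕ} {a b : Fin (m + 3)} (h : (cycleGraph (m + 3)).Adj a b) :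
    OnCycle (cycleGraph (m + 3)) s(a, b) :=
  ⟨_, cycleGraph.cycle m, cycleGraph.isCycle_cycle,
    cycleGraph_mem_edges cycleGraph.isCycle_cycle h⟩

theorem inGA_cycleGraph {A : Set ℕ} {m : ℕ} (hm : m + 3 ∈ A) : inGA A (cycleGraph (m + 3)) := by
  refine ⟨inferInstance, fun v c hc => ?_, fun v v' c c' hc hc' _ e => ?_, fun v c hc => ?_⟩
  · have hnd := hc.support_nodup
    have huniv : c.support.tail.toFinset = Finset.univ := by
      ext u
      simp only [List.mem_toFinset, Finset.mem_univ, iff_true]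
      have hu := cycleGraph_mem_support hc u
      rw [← Walk.cons_tail_support] at hu
      rcases List.mem_cons.1 hu with rfl | hu
      · exact Walk.end_mem_tail_support hc.not_nil
      · exact hu
    have hcard := congrArg Finset.card huniv
    rw [List.toFinset_card_of_nodup hnd, Finset.card_univ, Fintype.card_fin, List.length_tail,
      Walk.length_support, Nat.add_sub_cancel] at hcard
    rwa [hcard]
  · induction e with | _ a b =>
    exact ⟨fun h => cycleGraph_mem_edges hc' (c.adj_of_mem_edges h),
      fun h => cycleGraph_mem_edges hc (c'.adj_of_mem_edges h)⟩
  · simp [deg_cycleGraph]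

end CycleGraph

section Attach

/-- New edges may be attached at `s` without creating a cycle with three vertices of degree
greater than two. -/
def Admissible (X : SimpleGraph VX) (s : VX) : Prop :=
  ∀ (v : VX) (c : X.Walk v v), c.IsCycle → s ∈ c.support →
    (insert s {u | u ∈ c.support ∧ 2 < deg X u}).ncard ≤ 2

theorem admissible_of_two_lt_deg {A : Set ℕ} {X : SimpleGraph VX} (hX : inGA A X) {s : VX}
    (hs : 2 < deg X s) : Admissible X s := by
  intro v c hc hsc
  rw [Set.insert_eq_of_mem (show s ∈ {u | u ∈ c.support ∧ 2 < deg X u} from ⟨hsc, hs⟩)]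
  exact hX.2.2.2 v c hc

/-- `W` arises from `X` by attaching a cycle that meets `X` exactly in `a` and `b`. -/
structure IsAttach {X : SimpleGraph VX} {m : ℕ} {W : SimpleGraph VW} (a b : VX) (f : X ↪g W)
    (g : cycleGraph (m + 3) ↪g W) : Prop where
  cover : ∀ w, w ∈ Set.range f ∨ w ∈ Set.range g
  edge : ∀ w w', W.Adj w w' → (∃ x x', X.Adj x x' ∧ f x = w ∧ f x' = w') ∨ OnCycle W s(w, w')
  left_mem : f a ∈ Set.range g
  right_mem : f b ∈ Set.range g
  inter : ∀ x, f x ∈ Set.range g → x = a ∨ x = b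

/-- A cycle of length at least four can be attached at one or two admissible vertices
that are not joined by a path other than an edge. -/
theorem exists_isAttach {A : Set ℕ} {m : ℕ} (hm : m + 4 ∈ A) {X : SimpleGraph VX}
    (hX : inGA A X) {a b : VX} (ha : Admissible X a) (hb : Admissible X b)
    (hab : a ≠ b → ¬ (offGraph X {a, b}).Reachable a b) :
    ∃ (VW : Type) (W : SimpleGraph VW) (f : X ↪g W) (g : cycleGraph (m + 1 + 3) ↪g W),
      inGA A W ∧ IsAttach a b f g := by
  classical
  have := hX.1
  let T : Set VX := {a, b}
  let i : X.induce T ↪g X := Embedding.induce T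
  have hi : Set.range i = T := Subtype.range_coe
  let φ : VX → Fin (m + 1 + 3) := fun x => if x = a then 0 else if X.Adj a b then 1 else 2
  have h2 : (2 : Fin (m + 1 + 3)).val = 2 := Nat.mod_eq_of_lt (show 2 < m + 1 + 3 by omega)
  have h01 : (cycleGraph (m + 1 + 3)).Adj 0 1 := by simp [cycleGraph_adj]
  have h02 : ¬ (cycleGraph (m + 1 + 3)).Adj 0 2 := by
    rw [cycleGraph_adj', Fin.val_sub, Fin.val_sub, h2, Fin.val_zero, Nat.mod_eq_of_lt (by omega),
      show m + 1 + 3 - 0 + 2 = 2 + (m + 1 + 3) by omega, Nat.add_mod_right,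
      Nat.mod_eq_of_lt (by omega)]
    omega
  have hφa : φ a = 0 := if_pos rfl
  have hφb : a ≠ b → φ b ≠ 0 := fun h => by
    simp only [φ, if_neg h.symm]
    split_ifs
    · simp
    · exact fun h0 => absurd (h2.symm.trans (congrArg Fin.val h0)) (by simp)
  have hφ : a ≠ b → ((cycleGraph (m + 1 + 3)).Adj 0 (φ b) ↔ X.Adj a b) := fun h => by
    simp only [φ, if_neg h.symm]
    split_ifs with h' <;> simp [h', h01, h02]
  have hφinj : Function.Injective fun x : T => φ x := by
    rintro ⟨x, rfl | rfl⟩ ⟨y, rfl | rfl⟩ h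
    · rfl
    · by_contra hne
      exact hφb (fun h => hne (Subtype.ext h)) (h.symm.trans hφa)
    · by_contra hne
      exact hφb (fun h => hne (Subtype.ext h.symm)) (h.trans hφa)
    · rfl
  let j : X.induce T ↪g cycleGraph (m + 1 + 3) := ⟨⟨fun x => φ x, hφinj⟩, by
    rintro ⟨x, rfl | rfl⟩ ⟨y, rfl | rfl⟩
    · simp
    · by_cases hne : x = y
      · subst hne; simp
      · simpa [hφa] using hφ hne
    · by_cases hne : y = x
      · subst hne; simp
      · simpa [hφa, adj_comm] using hφ hne
    · simp⟩
  obtain ⟨VW, W, f, g, h⟩ := exists_isGlue i j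
  have := h.finite
  have hsep : Separated X (Set.range i) := by
    rw [hi]
    rintro s (rfl | rfl) t (rfl | rfl) hst
    · rfl
    · by_contra hne
      exact hab hne hst
    · by_contra hne
      exact hab (Ne.symm hne) hst.symm
    · rfl
  have hmem : ∀ x ∈ T, f x ∈ Set.range g := fun x hx => ⟨_, (h.comm ⟨x, hx⟩).symm⟩
  have hinter : ∀ x, f x ∈ Set.range g → x ∈ T := by
    rintro x ⟨y, hy⟩
    obtain ⟨⟨s, hs⟩, rfl, -⟩ := h.inter x y hy.symm
    exact hs
  refine ⟨VW, W, f, g, h.inGA hsep hX (inGA_cycleGraph hm) fun v c hc => ?_,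
    ⟨h.cover, fun w w' hw => ?_, hmem a (by simp [T]), hmem b (by simp [T]), hinter⟩⟩
  · rcases h.cycle_cases hsep hc with ⟨hr, hs⟩ | hr
    · obtain ⟨x, q, hq, -, hqs, -⟩ := exists_cycle_map_eq f hc hr
      obtain ⟨B, hB, hB₁, hB₂⟩ : ∃ B : Set VX, B.ncard ≤ 2 ∧
          (∀ u ∈ q.support, 2 < deg X u → u ∈ B) ∧ ∀ u ∈ q.support, u ∈ T → u ∈ B := by
        by_cases hex : ∃ s ∈ q.support, s ∈ T
        · obtain ⟨s, hsq, hsT⟩ := hex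
          refine ⟨insert s {u | u ∈ q.support ∧ 2 < deg X u}, ?_, fun u hu hd => Or.inr ⟨hu, hd⟩,
            fun u hu huT => Or.inl ?_⟩
          · rcases hsT with rfl | rfl
            · exact ha x q hq hsq
            · exact hb x q hq hsq
          · exact congrArg Subtype.val (hs ⟨u, huT⟩ ⟨s, hsT⟩ ((hqs u).2 hu) ((hqs s).2 hsq))
        · exact ⟨{u | u ∈ q.support ∧ 2 < deg X u}, hX.2.2.2 x q hq, fun u hu hd => ⟨hu, hd⟩,
            fun u hu huT => absurd ⟨u, hu, huT⟩ hex⟩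
      refine le_trans (Set.ncard_le_ncard (t := f '' B) ?_ (Set.toFinite _))
        ((Set.ncard_image_le (Set.toFinite _)).trans hB)
      rintro u ⟨huc, hud⟩
      obtain ⟨z, rfl⟩ := hr u huc
      have hzq := (hqs z).1 huc
      by_cases hzT : z ∈ T
      · exact ⟨z, hB₂ z hzq hzT, rfl⟩
      · exact ⟨z, hB₁ z hzq (hud.trans_le (deg_map_le_deg f z fun w hw =>
          h.adj_mem_range (by rwa [hi]) hw)), rfl⟩
    · refine le_trans (Set.ncard_le_ncard (t := f '' T) ?_ (Set.toFinite _))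
        ((Set.ncard_image_le (Set.toFinite _)).trans (Set.ncard_insert_le _ _ |>.trans (by simp)))
      rintro u ⟨huc, hud⟩
      obtain ⟨z, rfl⟩ := hr u huc
      by_cases hzj : z ∈ Set.range j
      · obtain ⟨⟨s, hs⟩, rfl⟩ := hzj
        exact ⟨s, hs, h.comm ⟨s, hs⟩⟩
      · have := deg_map_le_deg g z fun w hw => h.symm.adj_mem_range hzj hw
        rw [deg_cycleGraph] at this
        omega
  · rcases h.edge w w' hw with h' | ⟨y, y', hy, rfl, rfl⟩
    · exact Or.inl h'
    · exact Or.inr ((onCycle_cycleGraph hy).map g)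

namespace IsAttach

variable {X : SimpleGraph VX} {m : ℕ} {W : SimpleGraph VW} {a b : VX} {f : X ↪g W}
    {g : cycleGraph (m + 3) ↪g W}

theorem reachable {w w' : VW} (hw : w ∈ Set.range g) (hw' : w' ∈ Set.range g) :
    W.Reachable w w' := by
  obtain ⟨y, rfl⟩ := hw
  obtain ⟨y', rfl⟩ := hw'
  exact (cycleGraph_preconnected y y').map g.toHom

theorem onCycle {w w' : VW} (hw : w ∈ Set.range g) (hw' : w' ∈ Set.range g) (h : W.Adj w w') :
    OnCycle W s(w, w') := by
  obtain ⟨y, rfl⟩ := hw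
  obtain ⟨y', rfl⟩ := hw'
  exact (onCycle_cycleGraph (g.map_adj_iff.1 h)).map g

/-- Every vertex of the attached cycle lies on an edge of it whose other end is not a
prescribed vertex. -/
theorem exists_onCycle {w : VW} (hw : w ∈ Set.range g) (v : VW) :
    ∃ w' ∈ Set.range g, w' ≠ v ∧ W.Adj w w' ∧ OnCycle W s(w, w') := by
  obtain ⟨y, rfl⟩ := hw
  obtain ⟨z, w, hzw, hz, hw⟩ := exists_two_edges (cycleGraph.isCycle_cycle (n := m))
    (cycleGraph_mem_support cycleGraph.isCycle_cycle y)
  have hz' := Walk.adj_of_mem_edges _ hz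
  have hw' := Walk.adj_of_mem_edges _ hw
  by_cases h : g z = v
  · exact ⟨g w, ⟨w, rfl⟩, fun h' => hzw (g.injective (h.trans h'.symm)), g.map_adj_iff.2 hw',
      (onCycle_cycleGraph hw').map g⟩
  · exact ⟨g z, ⟨z, rfl⟩, h, g.map_adj_iff.2 hz', (onCycle_cycleGraph hz').map g⟩

end IsAttach

end Attach

section Hull

variable {G : SimpleGraph V} {X : SimpleGraph VX} {W : SimpleGraph VW}

/-- Distinct `u` and `v` are reachable from each other and an edge between them lies on a cycle;
a vertex is linked to itself when it lies on a cycle. -/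
def Linked (X : SimpleGraph VX) (u v : VX) : Prop :=
  X.Reachable u v ∧ (X.Adj u v → OnCycle X s(u, v)) ∧ (u = v → ∃ w, OnCycle X s(u, w))

theorem Linked.map (f : X ↪g W) {u v : VX} (h : Linked X u v) : Linked W (f u) (f v) :=
  ⟨h.1.map f.toHom, fun ha => (h.2.1 (f.map_adj_iff.1 ha)).map f,
    fun he => (h.2.2 (f.injective he)).elim fun w hw => ⟨f w, hw.map f⟩⟩

/-- An extension of `G` within `𝒢_A` whose new vertices are reachable from `G` and whose new
edges lie on cycles. -/
structure IsHull (A : Set ℕ) (ι : G ↪g X) : Prop where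
  inGA : inGA A X
  reach : ∀ x, ∃ v, X.Reachable x (ι v)
  edge : ∀ x y, X.Adj x y → (∃ u v, ι u = x ∧ ι v = y) ∨ OnCycle X s(x, y)

theorem IsHull.attach {A : Set ℕ} {ι : G ↪g X} (h : IsHull A ι) {m : ℕ} {a b : VX}
    {f : X ↪g W} {g : cycleGraph (m + 3) ↪g W} (hW : _root_.inGA A W) (hfg : IsAttach a b f g) :
    IsHull A (f.comp ι) where
  inGA := hW
  reach w := by
    rcases hfg.cover w with ⟨x, rfl⟩ | hw
    · obtain ⟨v, hv⟩ := h.reach x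
      exact ⟨v, hv.map f.toHom⟩
    · obtain ⟨v, hv⟩ := h.reach a
      exact ⟨v, (IsAttach.reachable hw hfg.left_mem).trans (hv.map f.toHom)⟩
  edge w w' hw := by
    rcases hfg.edge w w' hw with ⟨x, y, hxy, rfl, rfl⟩ | hc
    · rcases h.edge x y hxy with ⟨u, v, rfl, rfl⟩ | hc
      · exact Or.inl ⟨u, v, rfl, rfl⟩
      · exact Or.inr (hc.map f)
    · exact Or.inr hc

theorem exists_admissible {A : Set ℕ} (hX : inGA A X) (a : VX) :
    ∃ a', X.Reachable a a' ∧ Admissible X a' := by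
  by_cases hex : ∃ a', X.Reachable a a' ∧ 2 < deg X a'
  · obtain ⟨a', h, hd⟩ := hex
    exact ⟨a', h, admissible_of_two_lt_deg hX hd⟩
  · refine ⟨a, .refl _, fun v c hc ha => ?_⟩
    have hempty : {u | u ∈ c.support ∧ 2 < deg X u} = ∅ := by
      classical
      refine Set.eq_empty_of_forall_notMem fun u hu => hex ⟨u, ?_, hu.2⟩
      exact (c.takeUntil a ha).reachable.symm.trans (c.takeUntil u hu.1).reachable
    simp [hempty]

theorem admissible_of_not_onCycle {A : Set ℕ} (hX : inGA A X) {a b : VX} (hab : X.Adj a b)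
    (h : ¬ OnCycle X s(a, b)) : Admissible X a := by
  have := hX.1
  intro v c hc ha
  obtain ⟨p, q, hpq, hp, hq⟩ := exists_two_edges hc ha
  refine admissible_of_two_lt_deg hX (two_lt_deg hpq ?_ ?_ (c.adj_of_mem_edges hp)
    (c.adj_of_mem_edges hq) hab) v c hc ha
  · rintro rfl
    exact h ⟨v, c, hc, hp⟩
  · rintro rfl
    exact h ⟨v, c, hc, hq⟩

theorem IsHull.exists_linked {A : Set ℕ} {m : ℕ} (hm : m + 4 ∈ A) {ι : G ↪g X}
    (h : IsHull A ι) {u v : V} (huv : ¬ Linked X (ι u) (ι v)) :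
    ∃ (VW : Type) (W : SimpleGraph VW) (f : X ↪g W),
      IsHull A (f.comp ι) ∧ Linked W (f (ι u)) (f (ι v)) := by
  by_cases hr : X.Reachable (ι u) (ι v)
  swap
  · obtain ⟨a, hua, ha⟩ := exists_admissible h.inGA (ι u)
    obtain ⟨b, hvb, hb⟩ := exists_admissible h.inGA (ι v)
    obtain ⟨VW, W, f, g, hW, hfg⟩ := exists_isAttach hm h.inGA ha hb fun _ hab =>
      hr (hua.trans ((hab.mono (offGraph_le _ _)).trans hvb.symm))
    refine ⟨VW, W, f, h.attach hW hfg, ?_, fun hadj => ?_, fun he => ?_⟩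
    · exact (hua.map f.toHom).trans ((IsAttach.reachable hfg.left_mem hfg.right_mem).trans
        (hvb.map f.toHom).symm)
    · exact absurd (f.map_adj_iff.1 hadj).reachable hr
    · exact absurd (f.injective he ▸ .refl _) hr
  by_cases he : u = v
  · subst he
    have hno : ∀ w, ¬ OnCycle X s(ι u, w) := fun w hw => huv
      ⟨.refl _, fun hadj => absurd rfl hadj.ne, fun _ => ⟨w, hw⟩⟩
    have hadm : Admissible X (ι u) := fun v c hc hu => by
      obtain ⟨a, _, _, ha, _⟩ := exists_two_edges hc hu
      exact absurd ⟨v, c, hc, ha⟩ (hno a)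
    obtain ⟨VW, W, f, g, hW, hfg⟩ := exists_isAttach hm h.inGA hadm hadm fun hne => absurd rfl hne
    refine ⟨VW, W, f, h.attach hW hfg, .refl _, fun hadj => absurd rfl hadj.ne, fun _ => ?_⟩
    obtain ⟨w, -, -, -, hw⟩ := IsAttach.exists_onCycle hfg.left_mem (f (ι u))
    exact ⟨w, hw⟩
  · obtain ⟨hadj, hno⟩ : X.Adj (ι u) (ι v) ∧ ¬ OnCycle X s(ι u, ι v) := by
      by_contra hcon
      exact huv ⟨hr, fun hadj => by_contra fun hno => hcon ⟨hadj, hno⟩,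
        fun h => absurd (ι.injective h) he⟩
    obtain ⟨VW, W, f, g, hW, hfg⟩ := exists_isAttach hm h.inGA
      (admissible_of_not_onCycle h.inGA hadj hno)
      (admissible_of_not_onCycle h.inGA hadj.symm (by rwa [Sym2.eq_swap])) fun _ hab => by
        refine hno (adj_and_reachable_delete_edges_iff_exists_cycle.1 ⟨hadj, hab.mono ?_⟩)
        intro x y hxy
        refine ⟨hxy.1, fun hmem => hxy.2 ?_⟩
        have hmem := (fromEdgeSet_adj _).1 hmem |>.1
        rcases Sym2.eq_iff.1 (Set.mem_singleton_iff.1 hmem) with ⟨rfl, rfl⟩ | ⟨rfl, rfl⟩ <;> simp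
    exact ⟨VW, W, f, h.attach hW hfg, hr.map f.toHom,
      IsAttach.onCycle hfg.left_mem hfg.right_mem, fun h => absurd (ι.injective (f.injective h)) he⟩

theorem IsHull.exists_all_linked {A : Set ℕ} {m : ℕ} (hm : m + 4 ∈ A) [Finite V] (n : ℕ) :
    ∀ {VX : Type} {X : SimpleGraph VX} {ι : G ↪g X}, IsHull A ι →
      {p : V × V | ¬ Linked X (ι p.1) (ι p.2)}.ncard = n →
      ∃ (VW : Type) (W : SimpleGraph VW) (κ : G ↪g W),
        IsHull A κ ∧ ∀ u v, Linked W (κ u) (κ v) := by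
  induction n using Nat.strong_induction_on with
  | _ n ih =>
    intro VX X ι h hn
    by_cases hall : ∀ u v, Linked X (ι u) (ι v)
    · exact ⟨VX, X, ι, h, hall⟩
    push Not at hall
    obtain ⟨u, v, huv⟩ := hall
    obtain ⟨VW, W, f, hf, hl⟩ := h.exists_linked hm huv
    refine ih _ (hn ▸ Set.ncard_lt_ncard ⟨fun p hp hp' => hp (hp'.map f), fun hsub => ?_⟩
      (Set.toFinite _)) hf rfl
    exact hsub (show (u, v) ∈ _ from huv) hl

/-- Every graph in `𝒢_A` extends within `𝒢_A` to a connected graph without isolated vertices in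
which every edge lies on a cycle. -/
theorem exists_bridgeless {A : Set ℕ} {m : ℕ} (hm : m + 4 ∈ A) (hG : inGA A G) :
    ∃ (VW : Type) (W : SimpleGraph VW) (_ : G ↪g W), inGA A W ∧ W.Preconnected ∧
      (∀ x, ∃ y, W.Adj x y) ∧ ∀ x y, W.Adj x y → OnCycle W s(x, y) := by
  have := hG.1
  have hhull : IsHull A (Embedding.refl : G ↪g G) :=
    ⟨hG, fun x => ⟨x, .refl _⟩, fun x y _ => Or.inl ⟨x, y, rfl, rfl⟩⟩
  obtain ⟨VW, W, κ, hκ, hl⟩ := hhull.exists_all_linked hm _ rfl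
  refine ⟨VW, W, κ, hκ.inGA, fun x y => ?_, fun x => ?_, fun x y hxy => ?_⟩
  · obtain ⟨u, hu⟩ := hκ.reach x
    obtain ⟨v, hv⟩ := hκ.reach y
    exact hu.trans ((hl u v).1.trans hv.symm)
  · obtain ⟨u, ⟨p⟩⟩ := hκ.reach x
    cases p with
    | nil =>
      obtain ⟨w, v, c, -, hc⟩ := (hl u u).2.2 rfl
      exact ⟨w, c.adj_of_mem_edges hc⟩
    | cons h _ => exact ⟨_, h⟩
  · rcases hκ.edge x y hxy with ⟨u, v, rfl, rfl⟩ | h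
    · exact (hl u v).2.1 hxy
    · exact h

end Hull

section Saturation

variable {G : SimpleGraph V} {X : SimpleGraph VX}

/-- Every cycle of `G` has two vertices whose degree in the extension is greater than two. -/
def Saturated (h : G ↪g X) : Prop :=
  ∀ (v : V) (c : G.Walk v v), c.IsCycle → 2 ≤ {u | u ∈ c.support ∧ 2 < deg X (h u)}.ncard

theorem exists_deg_increase {A : Set ℕ} {m : ℕ} (hm : m + 4 ∈ A) [Finite V] (h : G ↪g X)
    (hX : inGA A X) (hsat : ¬ Saturated h) :
    ∃ u, deg X (h u) ≤ 2 ∧ ∃ (VW : Type) (W : SimpleGraph VW) (f : X ↪g W), inGA A W ∧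
      2 < deg W (f (h u)) := by
  have := hX.1
  unfold Saturated at hsat
  push Not at hsat
  obtain ⟨v, c, hc, hlt⟩ := hsat
  obtain ⟨u, huc, hud⟩ : ∃ u ∈ c.support, deg X (h u) ≤ 2 := by
    by_contra! hcon
    obtain ⟨a, _, _, ha, -⟩ := exists_two_edges hc c.start_mem_support
    refine hlt.not_ge ((Set.ncard_pair (c.adj_of_mem_edges ha).ne).ge.trans
      (Set.ncard_le_ncard ?_ (Set.toFinite _)))
    rintro z (rfl | rfl)
    · exact ⟨by simp, hcon _ (by simp)⟩
    · have := c.snd_mem_support_of_mem_edges ha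
      exact ⟨this, hcon _ this⟩
  have hhc := hc.map h.injective (f := h.toHom)
  have huh : h u ∈ (c.map h.toHom).support := by
    rw [Walk.support_map]
    exact List.mem_map.2 ⟨u, huc, rfl⟩
  have hadm : Admissible X (h u) := by
    intro v' c' hc' hu'
    obtain ⟨a, _, _, ha, -⟩ := exists_two_edges hhc huh
    have hsame := hX.2.2.1 _ _ c' _ hc' hhc
      ⟨_, mem_edges_of_deg_le hc' hu' hud (Walk.adj_of_mem_edges _ ha), ha⟩
    refine (Set.ncard_insert_le _ _).trans ?_
    suffices hle : {z | z ∈ c'.support ∧ 2 < deg X z}.ncard ≤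
        {u | u ∈ c.support ∧ 2 < deg X (h u)}.ncard by omega
    rw [← Set.ncard_image_of_injective {u | u ∈ c.support ∧ 2 < deg X (h u)} h.injective]
    refine Set.ncard_le_ncard ?_ (Set.toFinite _)
    rintro z ⟨hz, hzd⟩
    rw [mem_support_of_edges_iff hc' hhc hsame, Walk.support_map] at hz
    obtain ⟨y, hy, rfl⟩ := List.mem_map.1 hz
    exact ⟨y, ⟨hy, hzd⟩, rfl⟩
  obtain ⟨VW, W, f, g, hW, hfg⟩ := exists_isAttach hm hX hadm hadm fun hne => absurd rfl hne
  have := hW.1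
  refine ⟨u, hud, VW, W, f, hW, ?_⟩
  obtain ⟨a, b, hab, ha, hb⟩ := exists_two_edges hhc huh
  obtain ⟨w, hwg, -, hw, -⟩ := IsAttach.exists_onCycle hfg.left_mem (f (h u))
  have hnot : ∀ x, w ≠ f x := by
    rintro x rfl
    rcases hfg.inter x hwg with rfl | rfl <;> exact hw.ne rfl
  exact two_lt_deg (f.injective.ne hab) (hnot a) (hnot b)
    (f.map_adj_iff.2 (Walk.adj_of_mem_edges _ ha)) (f.map_adj_iff.2 (Walk.adj_of_mem_edges _ hb)) hw

theorem exists_saturated_aux {A : Set ℕ} {m : ℕ} (hm : m + 4 ∈ A) [Finite V] (n : ℕ) :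
    ∀ {VX : Type} {X : SimpleGraph VX} (h : G ↪g X), inGA A X →
      {u | deg X (h u) ≤ 2}.ncard = n →
      ∃ (VW : Type) (W : SimpleGraph VW) (k : G ↪g W), inGA A W ∧ Saturated k := by
  induction n using Nat.strong_induction_on with
  | _ n ih =>
    intro VX X h hX hn
    by_cases hsat : Saturated h
    · exact ⟨VX, X, h, hX, hsat⟩
    obtain ⟨u, hu, VW, W, f, hW, hu'⟩ := exists_deg_increase hm h hX hsat
    have := hW.1
    refine ih _ (hn ▸ Set.ncard_lt_ncard ⟨fun v hv => (deg_le_deg_map f _).trans hv,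
      fun hsub => ?_⟩ (Set.toFinite _)) (f.comp h) hW rfl
    exact (not_lt_of_ge (hsub hu)) hu'

theorem exists_saturated {A : Set ℕ} {m : ℕ} (hm : m + 4 ∈ A) (hG : inGA A G) :
    ∃ (VW : Type) (W : SimpleGraph VW) (k : G ↪g W), inGA A W ∧ Saturated k :=
  have := hG.1
  exists_saturated_aux hm _ Embedding.refl hG rfl

end Saturation

section Amalgamation

variable {K : SimpleGraph S} {X : SimpleGraph VX} {Y : SimpleGraph VY} {W : SimpleGraph VW}

/-- A connected induced subgraph, all of whose edges lie on cycles of it, is separated in every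
graph of `𝒢_A`. -/
theorem separated_range {A : Set ℕ} (hX : inGA A X) (i : K ↪g X) (hconn : K.Preconnected)
    (hcyc : ∀ s t, K.Adj s t → OnCycle K s(s, t)) : Separated X (Set.range i) := by
  rintro _ ⟨a, rfl⟩ _ ⟨b, rfl⟩ hoff
  obtain ⟨p, hp⟩ := (hconn a b).exists_isPath
  cases p with
  | nil => rfl
  | @cons _ u _ hau p =>
    exfalso
    rw [Walk.cons_isPath_iff] at hp
    obtain ⟨v, d, hd, hdu⟩ := hcyc a u hau
    obtain ⟨w, hwu, hdw⟩ := exists_edge_ne hd (d.fst_mem_support_of_mem_edges hdu) u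
    have hinj : s(i a, i u) ≠ s(i a, i w) := fun h =>
      hwu (i.injective (Sym2.congr_right.1 h).symm)
    let D := X.deleteEdges {s(i a, i w)}
    have hD : ∀ x y, X.Adj x y → (∀ z, s(x, y) ≠ s(i a, i z)) →
        (D.deleteEdges {s(i a, i u)}).Adj x y := fun x y hxy hne => by
      simp only [D, deleteEdges_adj, Set.mem_singleton_iff]
      exact ⟨⟨hxy, hne w⟩, hne u⟩
    have hwalk : ∀ {x y : S} (p : K.Walk x y), a ∉ p.support →
        (D.deleteEdges {s(i a, i u)}).Reachable (i x) (i y) := fun p => by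
      induction p with
      | nil => exact fun _ => .refl _
      | @cons x y z h p ih =>
        intro hap
        simp only [Walk.support_cons, List.mem_cons, not_or] at hap
        refine (Adj.reachable (hD _ _ (i.map_adj_iff.2 h) fun z hz => ?_)).trans (ih hap.2)
        rcases Sym2.eq_iff.1 hz with ⟨hx, -⟩ | ⟨-, hy⟩
        · exact hap.1 (i.injective hx).symm
        · exact hap.2 (i.injective hy ▸ p.start_mem_support)
    have hoffD : offGraph X (Set.range i) ≤ D.deleteEdges {s(i a, i u)} := by
      refine fun x y hxy => hD x y hxy.1 fun z hz => hxy.2 ?_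
      rcases Sym2.eq_iff.1 hz with ⟨rfl, rfl⟩ | ⟨rfl, rfl⟩ <;> simp
    have hDadj : D.Adj (i a) (i u) := by
      simp only [D, deleteEdges_adj, Set.mem_singleton_iff]
      exact ⟨i.map_adj_iff.2 hau, hinj⟩
    obtain ⟨x, c, hc, hcu⟩ := adj_and_reachable_delete_edges_iff_exists_cycle.1
      ⟨hDadj, (hoff.mono hoffD).trans (hwalk p hp.2).symm⟩
    have hmap : ∀ z, s(a, z) ∈ d.edges → s(i a, i z) ∈ (d.map i.toHom).edges := fun z hz => by
      rw [Walk.edges_map]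
      exact List.mem_map.2 ⟨_, hz, rfl⟩
    have hmem := (hX.2.2.1 _ _ (c.mapLe (deleteEdges_le _)) (d.map i.toHom) (hc.mapLe _)
      (hd.map i.injective) ⟨_, by rwa [Walk.edges_mapLe_eq_edges], hmap u hdu⟩ _).2 (hmap w hdw)
    rw [Walk.edges_mapLe_eq_edges] at hmem
    have := c.adj_of_mem_edges hmem
    simp [D, deleteEdges_adj] at this

theorem IsGlue.ncard_le_of_subset_range {i : K ↪g X} {j : K ↪g Y} {f : X ↪g W} {g : Y ↪g W}
    (h : IsGlue i j f g) {A : Set ℕ} (hX : _root_.inGA A X) (hK : ∀ s, ∃ t, K.Adj s t) {v : VW}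
    {c : W.Walk v v} (hc : c.IsCycle) (hr : ∀ w ∈ c.support, w ∈ Set.range f)
    (hs : ∀ s t, f (i s) ∈ c.support → f (i t) ∈ c.support → s = t) :
    {u | u ∈ c.support ∧ 2 < deg W u}.ncard ≤ 2 := by
  have := hX.1
  obtain ⟨x, q, hq, -, hqs, -⟩ := exists_cycle_map_eq f hc hr
  refine le_trans (Set.ncard_le_ncard (t := f '' {u | u ∈ q.support ∧ 2 < deg X u}) ?_
    (Set.toFinite _)) ((Set.ncard_image_le (Set.toFinite _)).trans (hX.2.2.2 x q hq))
  rintro u ⟨huc, hud⟩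
  obtain ⟨z, rfl⟩ := hr u huc
  have hzq := (hqs z).1 huc
  refine ⟨z, ⟨hzq, ?_⟩, rfl⟩
  by_cases hz : z ∈ Set.range i
  · obtain ⟨s, rfl⟩ := hz
    obtain ⟨t, hst⟩ := hK s
    obtain ⟨a, b, hab, ha, hb⟩ := exists_two_edges hq hzq
    have hne : ∀ y ∈ q.support, i t ≠ y := by
      rintro _ hy rfl
      exact hst.ne (hs s t huc ((hqs _).2 hy))
    exact two_lt_deg hab (hne a (q.snd_mem_support_of_mem_edges ha))
      (hne b (q.snd_mem_support_of_mem_edges hb)) (q.adj_of_mem_edges ha) (q.adj_of_mem_edges hb)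
      (i.map_adj_iff.2 hst)
  · exact hud.trans_le (deg_map_le_deg f z fun w hw => h.adj_mem_range hz hw)

/-- If a cycle of `K` contains at least two vertices that have degree greater than two in `X`, then
it contains exactly two, and its other vertices have no further neighbors in `X`. -/
theorem saturated_cycle {A : Set ℕ} (hX : inGA A X) (i : K ↪g X) {B : Set S}
    (hB : ∀ s ∈ B, 2 < deg X (i s)) {v : S} {c : K.Walk v v} (hc : c.IsCycle)
    (h2 : 2 ≤ {u | u ∈ c.support ∧ u ∈ B}.ncard) :
    {u | u ∈ c.support ∧ u ∈ B}.ncard ≤ 2 ∧ ∀ s ∈ c.support, s ∉ B →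
      deg X (i s) ≤ 2 ∧ ∀ x, X.Adj (i s) x → x ∈ Set.range i := by
  have := hX.1
  have hic := hc.map (f := i.toHom) i.injective
  have hmem : ∀ s ∈ c.support, i s ∈ (c.map i.toHom).support := fun s hs => by
    rw [Walk.support_map]
    exact List.mem_map.2 ⟨s, hs, rfl⟩
  have hle := hX.2.2.2 _ _ hic
  have hsub : i '' {u | u ∈ c.support ∧ u ∈ B} ⊆
      {u | u ∈ (c.map i.toHom).support ∧ 2 < deg X u} := by
    rintro _ ⟨s, ⟨hs, hsB⟩, rfl⟩
    exact ⟨hmem s hs, hB s hsB⟩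
  have hcard := Set.ncard_image_of_injective {u | u ∈ c.support ∧ u ∈ B} i.injective
  have heq := Set.eq_of_subset_of_ncard_le hsub (hle.trans (hcard ▸ h2)) (Set.toFinite _)
  refine ⟨by rwa [← hcard, heq], fun s hs hsB => ?_⟩
  have hd : deg X (i s) ≤ 2 := by
    by_contra! hlt
    obtain ⟨t, ht, hts⟩ : i s ∈ i '' {u | u ∈ c.support ∧ u ∈ B} := heq ▸ ⟨hmem s hs, hlt⟩
    exact hsB (i.injective hts ▸ ht.2)
  refine ⟨hd, fun x hx => ?_⟩
  have hx := Walk.snd_mem_support_of_mem_edges _ (mem_edges_of_deg_le hic (hmem s hs) hd hx)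
  rw [Walk.support_map] at hx
  obtain ⟨t, -, rfl⟩ := List.mem_map.1 hx
  exact ⟨t, rfl⟩

theorem IsGlue.inGA_of_saturated {i : K ↪g X} {j : K ↪g Y} {f : X ↪g W} {g : Y ↪g W}
    (h : IsGlue i j f g) {A : Set ℕ} (hX : _root_.inGA A X) (hY : _root_.inGA A Y)
    (hconn : K.Preconnected) (hK : ∀ s, ∃ t, K.Adj s t)
    (hcyc : ∀ s t, K.Adj s t → OnCycle K s(s, t)) {B : Set S}
    (hBX : ∀ s ∈ B, 2 < deg X (i s)) (hBY : ∀ s ∈ B, 2 < deg Y (j s))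
    (hsat : ∀ (v : S) (c : K.Walk v v), c.IsCycle →
      2 ≤ {u | u ∈ c.support ∧ u ∈ B}.ncard) : _root_.inGA A W := by
  have := hX.1
  have := hY.1
  have hsX := separated_range hX i hconn hcyc
  have hsY := separated_range hY j hconn hcyc
  refine h.inGA hsX hX hY fun v c hc => ?_
  rcases h.cycle_cases hsX hc with ⟨hr, hs⟩ | hrg
  · exact h.ncard_le_of_subset_range hX hK hc hr hs
  rcases h.symm.cycle_cases hsY hc with ⟨hr, hs⟩ | hrf
  · exact h.symm.ncard_le_of_subset_range hY hK hc hr hs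
  have := Finite.of_injective i i.injective
  let e : K ↪g W := f.comp i
  have hr : ∀ w ∈ c.support, w ∈ Set.range e := by
    intro w hw
    obtain ⟨x, rfl⟩ := hrf w hw
    obtain ⟨y, hy⟩ := hrg _ hw
    obtain ⟨s, rfl, -⟩ := h.inter x y hy.symm
    exact ⟨s, rfl⟩
  obtain ⟨x, q, hq, -, hqs, -⟩ := exists_cycle_map_eq e hc hr
  obtain ⟨hle, hqX⟩ := saturated_cycle hX i hBX hq (hsat x q hq)
  obtain ⟨-, hqY⟩ := saturated_cycle hY j hBY hq (hsat x q hq)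
  refine le_trans (Set.ncard_le_ncard (t := e '' {u | u ∈ q.support ∧ u ∈ B}) ?_
    (Set.toFinite _)) ((Set.ncard_image_le (Set.toFinite _)).trans hle)
  rintro u ⟨huc, hud⟩
  obtain ⟨s, rfl⟩ := hr u huc
  have hsq := (hqs s).1 huc
  refine ⟨s, ⟨hsq, by_contra fun hsB => ?_⟩, rfl⟩
  obtain ⟨hdX, hnX⟩ := hqX s hsq hsB
  obtain ⟨-, hnY⟩ := hqY s hsq hsB
  have hnW : ∀ w, W.Adj (e s) w → w ∈ Set.range e := by
    intro w hw
    rcases h.edge _ _ hw with ⟨z, z', hz, hzs, rfl⟩ | ⟨z, z', hz, hzs, rfl⟩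
    · obtain rfl := f.injective hzs
      obtain ⟨t, rfl⟩ := hnX z' hz
      exact ⟨t, rfl⟩
    · obtain rfl := g.injective (hzs.trans (h.comm s))
      obtain ⟨t, rfl⟩ := hnY z' hz
      exact ⟨t, h.comm t⟩
  have := (deg_map_le_deg e s hnW).trans ((deg_le_deg_map i s).trans hdX)
  omega

end Amalgamation

end WeakAmalgamation

open WeakAmalgamation

/-- The class `𝒢_A` has the weak amalgamation property. -/
theorem stmt12 (A : Set ℕ) (hA : A ⊆ {n | 3 ≤ n}) (hA2 : A.Nontrivial)
    {V : Type} (G : SimpleGraph V) (hG : inGA A G) :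
    ∃ (V' : Type) (H' : SimpleGraph V') (ι : G ↪g H'),
      inGA A H' ∧
      ∀ (VX VY : Type) (X : SimpleGraph VX) (Y : SimpleGraph VY)
        (f : H' ↪g X) (g : H' ↪g Y),
        inGA A X → inGA A Y →
        ∃ (VW : Type) (W : SimpleGraph VW) (f' : X ↪g W) (g' : Y ↪g W),
          inGA A W ∧ ∀ x : V, f' (f (ι x)) = g' (g (ι x)) := by
  obtain ⟨m, hm⟩ : ∃ m, m + 4 ∈ A := by
    obtain ⟨n, hn, hne⟩ := hA2.exists_ne 3
    have h3 : 3 ≤ n := hA hn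
    exact ⟨n - 4, by rwa [Nat.sub_add_cancel (by omega)]⟩
  obtain ⟨S, K, ι, hK, hconn, hiso, hcyc⟩ := exists_bridgeless hm hG
  obtain ⟨V', H, k, hH, hsat⟩ := exists_saturated hm hK
  refine ⟨V', H, k.comp ι, hH, fun VX VY X Y f g hX hY => ?_⟩
  have := hX.1
  have := hY.1
  obtain ⟨VW, W, f', g', h⟩ := exists_isGlue (f.comp k) (g.comp k)
  exact ⟨VW, W, f', g', h.inGA_of_saturated hX hY hconn hiso hcyc (B := {s | 2 < deg H (k s)})
    (fun s hs => hs.trans_le (deg_le_deg_map f _)) (fun s hs => hs.trans_le (deg_le_deg_map g _))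
    hsat, fun x => h.comm (ι x)⟩
end

section
/- The assignment A ↦ 𝒢_A is injective: if A and B are subsets of ℕ \ {0,1,2}, each of size at least 2, and A ≠ B, then 𝒢_A ≠ 𝒢_B; consequently there are continuum many pairwise distinct hereditary classes of finite graphs of the form 𝒢_A. -/
/-- The class `𝒢_A`, viewed as the family of its members on the standard finite vertex
sets `Fin n` (every finite graph is isomorphic to one of this form). -/
def classGA (A : Set ℕ) : (n : ℕ) → Set (SimpleGraph (Fin n)) :=
  fun n => {G : SimpleGraph (Fin n) | inGA A G}

open SimpleGraph

theorem deg_cycleGraph (n : ℕ) (v : Fin (n + 3)) : deg (cycleGraph (n + 3)) v = 2 := by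
  rw [← cycleGraph_degree_three_le (n := n) (v := v), ← card_neighborSet_eq_degree,
    ← Nat.card_eq_fintype_card]
  rfl

theorem cycleGraph_isCycles (n : ℕ) : (cycleGraph (n + 3)).IsCycles :=
  fun v _ ↦ deg_cycleGraph n v

/-- In a connected graph all of whose vertices have degree two, a cycle uses every edge. -/
theorem SimpleGraph.Walk.IsCycle.mem_edges_iff_of_isCycles {V : Type*} {G : SimpleGraph V}
    [LocallyFinite G] {v : V} {c : G.Walk v v} (hc : c.IsCycle) (hG : G.IsCycles)
    (hconn : G.Preconnected) (e : Sym2 V) : e ∈ c.edges ↔ e ∈ G.edgeSet := by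
  refine ⟨fun h ↦ c.edges_subset_edgeSet h, fun h ↦ ?_⟩
  have key : ∀ x w, x ∈ c.support → G.Adj x w → s(x, w) ∈ c.edges := fun x w hx hxw ↦
    Walk.adj_toSubgraph_iff_mem_edges.mp <|
      (hc.adj_toSubgraph_iff_of_isCycles hG (c.mem_verts_toSubgraph.mpr hx) w).mpr hxw
  have hall : ∀ x, x ∈ c.support := by
    intro x
    obtain ⟨p⟩ := hconn x v
    induction p with
    | nil => exact c.start_mem_support
    | cons hadj _ ih =>
      exact c.snd_mem_support_of_mem_edges (key _ _ (ih hc key) hadj.symm)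
  induction e with
  | _ x w => exact key x w (hall x) h

theorem length_eq_of_isCycle_cycleGraph {n : ℕ} {v : Fin (n + 3)}
    {c : (cycleGraph (n + 3)).Walk v v} (hc : c.IsCycle) : c.length = n + 3 := by
  have hmem : ∀ {u : Fin (n + 3)} {d : (cycleGraph (n + 3)).Walk u u}, d.IsCycle →
      ∀ e, e ∈ d.edges ↔ e ∈ (cycleGraph (n + 3)).edgeSet := fun hd ↦
    hd.mem_edges_iff_of_isCycles (cycleGraph_isCycles n) cycleGraph_preconnected
  have hcyc := cycleGraph.isCycle_cycle (n := n)
  refine Eq.trans ?_ (cycleGraph.length_cycle (n := n))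
  rw [← Walk.length_edges, ← Walk.length_edges]
  refine List.Perm.length_eq ((List.perm_ext_iff_of_nodup hc.edges_nodup hcyc.edges_nodup).mpr ?_)
  exact fun e ↦ (hmem hc e).trans (hmem hcyc e).symm

theorem cycleGraph_mem_classGA_iff {A : Set ℕ} {n : ℕ} :
    cycleGraph (n + 3) ∈ classGA A (n + 3) ↔ n + 3 ∈ A := by
  constructor
  · rintro ⟨-, h, -⟩
    simpa using h 0 (cycleGraph.cycle n) cycleGraph.isCycle_cycle
  · refine fun h ↦ ⟨inferInstance, fun v c hc ↦ ?_, fun v w c d hc hd _ e ↦ ?_, fun v c _ ↦ ?_⟩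
    · rwa [length_eq_of_isCycle_cycleGraph hc]
    · rw [hc.mem_edges_iff_of_isCycles (cycleGraph_isCycles n) cycleGraph_preconnected,
        hd.mem_edges_iff_of_isCycles (cycleGraph_isCycles n) cycleGraph_preconnected]
    · simp [deg_cycleGraph]

theorem eq_of_classGA_eq {A B : Set ℕ} (hA : A ⊆ {n | 3 ≤ n}) (hB : B ⊆ {n | 3 ≤ n})
    (h : classGA A = classGA B) : A = B := by
  have hiff : ∀ n, n + 3 ∈ A ↔ n + 3 ∈ B := fun n ↦ by
    rw [← cycleGraph_mem_classGA_iff, ← cycleGraph_mem_classGA_iff, h]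
  ext n
  constructor <;> intro hn
  · obtain ⟨k, rfl⟩ := Nat.exists_eq_add_of_le' (hA hn)
    exact (hiff k).mp hn
  · obtain ⟨k, rfl⟩ := Nat.exists_eq_add_of_le' (hB hn)
    exact (hiff k).mpr hn

/-- An injective encoding of sets of naturals as nontrivial sets of naturals at least `3`. -/
def shiftWithBase (S : Set ℕ) : Set ℕ := {3, 4} ∪ Set.image (· + 5) S

theorem shiftWithBase_subset (S : Set ℕ) : shiftWithBase S ⊆ {n | 3 ≤ n} := by
  rintro n ((rfl | rfl) | ⟨m, -, rfl⟩) <;> simp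

theorem shiftWithBase_nontrivial (S : Set ℕ) : (shiftWithBase S).Nontrivial :=
  ⟨3, by simp [shiftWithBase], 4, by simp [shiftWithBase], by decide⟩

theorem shiftWithBase_injective : Function.Injective shiftWithBase := by
  intro S T h
  have hmem : ∀ (U : Set ℕ) n, n + 5 ∈ shiftWithBase U ↔ n ∈ U := by simp [shiftWithBase]
  ext n
  rw [← hmem, h, hmem]

/-- The assignment `A ↦ 𝒢_A` is injective, and consequently there are continuum many
pairwise distinct classes of the form `𝒢_A`. -/
theorem stmt13 :
    (∀ A B : Set ℕ, A ⊆ {n | 3 ≤ n} → B ⊆ {n | 3 ≤ n} → A.Nontrivial → B.Nontrivial →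
      A ≠ B → classGA A ≠ classGA B) ∧
    Cardinal.mk {K : (n : ℕ) → Set (SimpleGraph (Fin n)) //
      ∃ A : Set ℕ, A ⊆ {n | 3 ≤ n} ∧ A.Nontrivial ∧ K = classGA A} =
      Cardinal.continuum := by
  refine ⟨fun A B hA hB _ _ hne h ↦ hne (eq_of_classGA_eq hA hB h), ?_⟩
  rw [← Cardinal.mk_set_nat]
  apply le_antisymm
  · refine Cardinal.mk_le_of_injective (f := fun K ↦ K.2.choose) fun K L h ↦ Subtype.ext ?_
    rw [K.2.choose_spec.2.2, L.2.choose_spec.2.2]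
    exact congrArg classGA h
  · refine Cardinal.mk_le_of_injective (f := fun S ↦ ⟨classGA (shiftWithBase S), shiftWithBase S,
      shiftWithBase_subset S, shiftWithBase_nontrivial S, rfl⟩) fun S T h ↦ ?_
    exact shiftWithBase_injective <| eq_of_classGA_eq (shiftWithBase_subset S)
      (shiftWithBase_subset T) (congrArg Subtype.val h)
end

section
/- The structure (ℚ, R) is weakly homogeneous, uniformly with witness of size |A| + 1: for every finite set A ⊆ ℚ there exists a finite set B ⊆ ℚ with A ⊆ B and |B| ≤ |A| + 1, such that for every injective map g : B → ℚ satisfying R(x,y,z) ↔ R(g x, g y, g z) for all x, y, z ∈ B, the restriction of g to A extends to a bijection σ : ℚ → ℚ satisfying R(x,y,z) ↔ R(σ x, σ y, σ z) for all x, y, z ∈ ℚ. -/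
/-- Pouzet's ternary relation on `ℚ`. -/
def R (x y z : ℚ) : Prop := x < y ∧ x < z ∧ y ≠ z

open Order Order.PartialIso in
/-- Every finite partial isomorphism between countable dense linear orders without endpoints
extends to an order isomorphism. -/
theorem Order.PartialIso.exists_orderIso_extending {α β : Type*} [LinearOrder α] [LinearOrder β]
    [Countable α] [DenselyOrdered α] [NoMinOrder α] [NoMaxOrder α] [Nonempty α]
    [Countable β] [DenselyOrdered β] [NoMinOrder β] [NoMaxOrder β] [Nonempty β]
    (f : PartialIso α β) : ∃ e : α ≃o β, ∀ p ∈ f.val, e p.1 = p.2 := by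
  cases nonempty_encodable α
  cases nonempty_encodable β
  let toCofinal : α ⊕ β → Cofinal (PartialIso α β) := fun p ↦
    Sum.recOn p (definedAtLeft β) (definedAtRight α)
  let I : Ideal (PartialIso α β) := idealOfCofinals f toCofinal
  let F a := funOfIdeal a I (cofinal_meets_idealOfCofinals f toCofinal (Sum.inl a))
  let G b := invOfIdeal b I (cofinal_meets_idealOfCofinals f toCofinal (Sum.inr b))
  refine ⟨OrderIso.ofCmpEqCmp (fun a ↦ (F a).val) (fun b ↦ (G b).val) fun a b ↦ ?_, ?_⟩
  · rcases (F a).prop with ⟨p, hp, ha⟩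
    rcases (G b).prop with ⟨q, hq, hb⟩
    rcases I.directed _ hp _ hq with ⟨m, _, hpm, hqm⟩
    exact m.prop (a, _) (hpm ha) (_, b) (hqm hb)
  · rintro ⟨a, b⟩ hab
    rcases (F a).prop with ⟨p, hp, ha⟩
    rcases I.directed _ hp _ (mem_idealOfCofinals f toCofinal) with ⟨m, _, hpm, hfm⟩
    have h := m.prop (a, _) (hpm ha) (a, b) (hfm hab)
    rw [cmp_self_eq_eq] at h
    exact cmp_eq_eq_iff _ _ |>.1 h.symm

/-- A strictly monotone map on a finite set extends to an order isomorphism between countable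
dense linear orders without endpoints. -/
theorem StrictMonoOn.exists_orderIso_eqOn {α β : Type*} [LinearOrder α] [LinearOrder β]
    [Countable α] [DenselyOrdered α] [NoMinOrder α] [NoMaxOrder α] [Nonempty α]
    [Countable β] [DenselyOrdered β] [NoMinOrder β] [NoMaxOrder β] [Nonempty β]
    {g : α → β} {s : Finset α} (hg : StrictMonoOn g s) : ∃ e : α ≃o β, Set.EqOn e g s := by
  let f : Order.PartialIso α β := ⟨s.image fun a ↦ (a, g a), by
    simp only [Finset.mem_image]
    rintro _ ⟨a, ha, rfl⟩ _ ⟨b, hb, rfl⟩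
    exact (hg.cmp_map_eq ha hb).symm⟩
  obtain ⟨e, he⟩ := f.exists_orderIso_extending
  exact ⟨e, fun a ha ↦ he (a, g a) (Finset.mem_image_of_mem _ ha)⟩

/-- `(ℚ, R)` is weakly homogeneous, uniformly with witnesses of size `|A| + 1`. -/
theorem stmt14 (A : Finset ℚ) :
    ∃ B : Finset ℚ, A ⊆ B ∧ B.card ≤ A.card + 1 ∧
      ∀ g : ℚ → ℚ, Set.InjOn g ↑B →
        (∀ x ∈ B, ∀ y ∈ B, ∀ z ∈ B, (R x y z ↔ R (g x) (g y) (g z))) →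
        ∃ σ : ℚ ≃ ℚ, (∀ x y z : ℚ, R x y z ↔ R (σ x) (σ y) (σ z)) ∧
          ∀ a ∈ A, σ a = g a := by
  obtain ⟨c, hc⟩ : ∃ c, ∀ a ∈ A, a < c := by
    obtain ⟨m, hm⟩ := A.bddAbove
    exact ⟨m + 1, fun a ha ↦ (hm ha).trans_lt (lt_add_one m)⟩
  refine ⟨insert c A, Finset.subset_insert c A, Finset.card_insert_le c A, fun g _ hR ↦ ?_⟩
  have hg : StrictMonoOn g A := fun x hx y hy hxy ↦
    ((hR x (Finset.mem_insert_of_mem hx) y (Finset.mem_insert_of_mem hy) c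
      (Finset.mem_insert_self c A)).1 ⟨hxy, hc x hx, (hc y hy).ne⟩).1
  obtain ⟨e, he⟩ := hg.exists_orderIso_eqOn
  exact ⟨e.toEquiv, fun x y z ↦ by simp [R], fun a ha ↦ he ha⟩
end

section
/- The structure (ℚ, R) is not cofinally homogeneous: for every finite set B ⊆ ℚ with |B| ≥ 2, there exists an injective map f : B → ℚ satisfying R(x,y,z) ↔ R(f x, f y, f z) for all x, y, z ∈ B, such that no bijection σ : ℚ → ℚ satisfying R(x,y,z) ↔ R(σ x, σ y, σ z) for all x, y, z ∈ ℚ extends f. -/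
/-- Every `R`-preserving map is strictly increasing. -/
lemma strictMono_of_R {σ : ℚ → ℚ} (hσ : ∀ x y z : ℚ, R x y z → R (σ x) (σ y) (σ z)) :
    StrictMono σ := fun x y hxy =>
  (hσ x y (y + 1) ⟨hxy, by linarith, (lt_add_one y).ne⟩).1

/-- Swapping the two largest elements of a set preserves `R` on it. -/
lemma R_swap_iff {m M x y z : ℚ} (hmM : m < M) (hx : x < m ∨ x = m ∨ x = M)
    (hy : y < m ∨ y = m ∨ y = M) (hz : z < m ∨ z = m ∨ z = M) :
    R x y z ↔ R (Equiv.swap m M x) (Equiv.swap m M y) (Equiv.swap m M z) := by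
  simp only [R, Equiv.swap_apply_def]
  grind

/-- `(ℚ, R)` is not cofinally homogeneous: over every finite `B ⊆ ℚ` with at least two
elements there is an embedding of `B` into `(ℚ, R)` extending to no automorphism. -/
theorem stmt15 (B : Finset ℚ) (hB : 2 ≤ B.card) :
    ∃ f : ℚ → ℚ, Set.InjOn f ↑B ∧
      (∀ x ∈ B, ∀ y ∈ B, ∀ z ∈ B, (R x y z ↔ R (f x) (f y) (f z))) ∧
      ¬ ∃ σ : ℚ ≃ ℚ, (∀ x y z : ℚ, R x y z ↔ R (σ x) (σ y) (σ z)) ∧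
          ∀ b ∈ B, σ b = f b := by
  obtain ⟨M, hM, hMmax⟩ := B.exists_max_image id (Finset.card_pos.mp (by omega))
  have hne : (B.erase M).Nonempty :=
    Finset.card_pos.mp (by rw [Finset.card_erase_of_mem hM]; omega)
  obtain ⟨m, hm, hmmax⟩ := (B.erase M).exists_max_image id hne
  obtain ⟨hmne, hmB⟩ := Finset.mem_erase.mp hm
  have hmM : m < M := lt_of_le_of_ne (hMmax m hmB) hmne
  have key : ∀ x ∈ B, x < m ∨ x = m ∨ x = M := fun x hx => by
    by_cases h : x = M
    · exact .inr (.inr h)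
    · exact (lt_or_eq_of_le (hmmax x (Finset.mem_erase.mpr ⟨h, hx⟩))).imp_right .inl
  refine ⟨Equiv.swap m M, (Equiv.injective _).injOn,
    fun x hx y hy z hz => R_swap_iff hmM (key x hx) (key y hy) (key z hz), ?_⟩
  rintro ⟨σ, hσ, hext⟩
  have h := strictMono_of_R (fun x y z => (hσ x y z).mp) hmM
  rw [hext m hmB, hext M hM, Equiv.swap_apply_left, Equiv.swap_apply_right] at h
  exact lt_asymm h hmM
end

section
/- Every automorphism of (ℚ, R) is order-preserving: if σ : ℚ → ℚ is a bijection satisfying R(x,y,z) ↔ R(σ x, σ y, σ z) for all x, y, z ∈ ℚ, then for all x, y ∈ ℚ, x < y if and only if σ x < σ y. -/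
/-- The order of `ℚ` is definable from `R`. -/
theorem lt_iff_exists_R (x y : ℚ) : x < y ↔ ∃ z, R x y z :=
  ⟨fun h => ⟨y + 1, h, by linarith, (lt_add_one y).ne⟩,
    fun ⟨_, h⟩ => h.1⟩

/-- Every automorphism of `(ℚ, R)` is order-preserving. -/
theorem stmt16 (σ : ℚ ≃ ℚ) (hσ : ∀ x y z : ℚ, R x y z ↔ R (σ x) (σ y) (σ z)) :
    ∀ x y : ℚ, x < y ↔ σ x < σ y := by
  intro x y
  rw [lt_iff_exists_R, lt_iff_exists_R]
  exact σ.exists_congr fun z => hσ x y z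
end

section
/- A finite structure (X, R') with a ternary relation R' embeds into (ℚ, R) if and only if for all x, y, z, w, w' ∈ X: (1) R'(x,y,z) implies x, y, z are pairwise distinct; (2) R'(x,y,z) implies R'(x,z,y); (3) R'(x,y,w) and R'(y,z,w') imply R'(x,z,w'); (4) if x, y, z are pairwise distinct then exactly one of R'(x,y,z), R'(y,z,x), R'(z,x,y) holds. Here an embedding is an injective map f : X → ℚ such that R'(x,y,z) ↔ R(f x, f y, f z) for all x, y, z ∈ X. -/
/-- On a countable type, every transitive irreflexive relation is respected by some injective map
to `ℚ`. -/
theorem exists_injective_rat_of_trans_irrefl {X : Type*} [Countable X] (r : X → X → Prop)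
    (irrefl : ∀ x, ¬ r x x) (trans : ∀ x y z, r x y → r y z → r x z) :
    ∃ f : X → ℚ, Function.Injective f ∧ ∀ x y, r x y → f x < f y := by
  let P : PartialOrder X :=
    { le := fun x y => x = y ∨ r x y
      le_refl := fun x => Or.inl rfl
      le_trans := by
        rintro x y z (rfl | hxy) (rfl | hyz)
        exacts [Or.inl rfl, Or.inr hyz, Or.inr hxy, Or.inr (trans _ _ _ hxy hyz)]
      le_antisymm := by
        rintro x y (rfl | hxy) (h | hyx)
        exacts [rfl, rfl, h.symm, (irrefl _ (trans _ _ _ hxy hyx)).elim] }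
  have : Countable (LinearExtension X) := ‹Countable X›
  obtain ⟨g⟩ := Order.embedding_from_countable_to_dense (LinearExtension X) ℚ
  have hinj : Function.Injective fun x : X => g (toLinearExtension x) :=
    fun x y h => g.injective h
  refine ⟨_, hinj, fun x y hxy => lt_of_le_of_ne ?_ ?_⟩
  · have hle : x ≤ y := Or.inr hxy
    exact g.monotone (toLinearExtension.monotone hle)
  · exact hinj.ne fun h => irrefl y (h ▸ hxy)

/-- A finite ternary structure `(X, R')` embeds into `(ℚ, R)` if and only if it
satisfies the four axioms (1)–(4). -/
theorem stmt17 {X : Type} [Fintype X] (R' : X → X → X → Prop) :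
    (∃ f : X → ℚ, Function.Injective f ∧
        ∀ x y z : X, R' x y z ↔ R (f x) (f y) (f z)) ↔
      ((∀ x y z, R' x y z → x ≠ y ∧ x ≠ z ∧ y ≠ z) ∧
       (∀ x y z, R' x y z → R' x z y) ∧
       (∀ x y z w w', R' x y w → R' y z w' → R' x z w') ∧
       (∀ x y z, x ≠ y → x ≠ z → y ≠ z →
         ((R' x y z ∧ ¬ R' y z x ∧ ¬ R' z x y) ∨
          (¬ R' x y z ∧ R' y z x ∧ ¬ R' z x y) ∨
          (¬ R' x y z ∧ ¬ R' y z x ∧ R' z x y)))) := by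
  constructor
  · rintro ⟨f, hf, h⟩
    simp only [h, R]
    refine ⟨?_, ?_, ?_, ?_⟩
    · rintro x y z ⟨hxy, hxz, hyz⟩
      exact ⟨fun e => hxy.ne (congrArg f e), fun e => hxz.ne (congrArg f e),
        fun e => hyz (congrArg f e)⟩
    · rintro x y z ⟨hxy, hxz, hyz⟩
      exact ⟨hxz, hxy, hyz.symm⟩
    · rintro x y z w w' ⟨hxy, -, -⟩ ⟨hyz, hyw, hzw⟩
      exact ⟨hxy.trans hyz, hxy.trans hyw, hzw⟩
    · intro x y z hxy hxz hyz
      have hxy := hf.ne hxy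
      have hxz := hf.ne hxz
      have hyz := hf.ne hyz
      grind
  · rintro ⟨distinct, symm, trans, cover⟩
    obtain ⟨f, hf, hlt⟩ := exists_injective_rat_of_trans_irrefl (fun x y => ∃ w, R' x y w)
      (fun x ⟨w, h⟩ => (distinct _ _ _ h).1 rfl)
      (fun x y z ⟨w, h⟩ ⟨w', h'⟩ => ⟨w', trans _ _ _ _ _ h h'⟩)
    refine ⟨f, hf, fun x y z => ⟨fun h => ?_, fun ⟨hxy, hxz, hyz⟩ => ?_⟩⟩
    · exact ⟨hlt _ _ ⟨z, h⟩, hlt _ _ ⟨y, symm _ _ _ h⟩, hf.ne (distinct _ _ _ h).2.2⟩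
    · rcases cover x y z (fun e => hxy.ne (congrArg f e)) (fun e => hxz.ne (congrArg f e))
        (fun e => hyz (congrArg f e)) with ⟨h, -, -⟩ | ⟨-, h, -⟩ | ⟨-, -, h⟩
      · exact h
      · exact (lt_asymm hxy (hlt _ _ ⟨z, symm _ _ _ h⟩)).elim
      · exact (lt_asymm hxz (hlt _ _ ⟨y, h⟩)).elim
end

section
/- The complete first-order theory of the structure (ℚ, R), in the language with a single ternary relation symbol interpreted as R, is ℵ₀-categorical: any two countably infinite models of this theory are isomorphic. -/
open FirstOrder

/-- The relation symbols of the language `L`: a single ternary relation symbol. -/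
inductive Rels : ℕ → Type
  | r : Rels 3

/-- The language with a single ternary relation symbol and no function symbols. -/
def L : FirstOrder.Language :=
  ⟨fun _ => Empty, Rels⟩

/-- `ℚ` as an `L`-structure, interpreting the ternary relation symbol as `R`. -/
noncomputable instance : L.Structure ℚ where
  funMap := fun f _ => f.elim
  RelMap := fun {n} rel v =>
    match n, rel, v with
    | _, .r, v => R (v 0) (v 1) (v 2)

namespace RatTernary

open FirstOrder.Language

/-- The relation symbol of `L`. -/
def ternarySymb : L.Relations 3 := Rels.r

/-- The interpretation of the relation symbol of `L` in a structure. -/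
def Ternary {M : Type*} [L.Structure M] (x y z : M) : Prop :=
  Structure.RelMap ternarySymb ![x, y, z]

/-- The binary relation `∃ z, R(x, y, z)`, which on `ℚ` is the strict order. -/
def TernaryLT {M : Type*} [L.Structure M] (x y : M) : Prop :=
  ∃ z, Ternary x y z

/-- The atomic formula `R(xᵢ, xⱼ, xₖ)`. -/
def ternaryFormula {n : ℕ} (i j k : Fin n) : L.BoundedFormula Empty n :=
  ternarySymb.boundedFormula
    ![Term.var (Sum.inr i), Term.var (Sum.inr j), Term.var (Sum.inr k)]

/-- The formula `∃ z, R(xᵢ, xⱼ, z)`. -/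
def ltFormula {n : ℕ} (i j : Fin n) : L.BoundedFormula Empty n :=
  (ternaryFormula i.castSucc j.castSucc (Fin.last n)).ex

/-- The formula `xᵢ = xⱼ`. -/
def eqFormula {n : ℕ} (i j : Fin n) : L.BoundedFormula Empty n :=
  Term.bdEqual (Term.var (Sum.inr i)) (Term.var (Sum.inr j))

section Realize

variable {M : Type*} [L.Structure M] {n : ℕ} {v : Empty → M} {xs : Fin n → M}

@[simp]
theorem realize_ternaryFormula (i j k : Fin n) :
    (ternaryFormula i j k).Realize v xs ↔ Ternary (xs i) (xs j) (xs k) := by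
  rw [ternaryFormula, BoundedFormula.realize_rel, Ternary]
  congr! 1
  ext l
  fin_cases l <;> rfl

@[simp]
theorem realize_ltFormula (i j : Fin n) :
    (ltFormula i j).Realize v xs ↔ TernaryLT (xs i) (xs j) := by
  simp [ltFormula, TernaryLT]

@[simp]
theorem realize_eqFormula (i j : Fin n) :
    (eqFormula i j : L.BoundedFormula Empty n).Realize v xs ↔ xs i = xs j := by
  simp [eqFormula]

end Realize

theorem ternary_rat_iff (x y z : ℚ) : Ternary x y z ↔ x < y ∧ x < z ∧ y ≠ z :=
  Iff.rfl

theorem ternaryLT_rat_iff (x y : ℚ) : TernaryLT x y ↔ x < y := by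
  simp only [TernaryLT, ternary_rat_iff]
  refine ⟨fun ⟨_, h, _⟩ => h, fun h => ⟨y + 1, h, by linarith, by simp⟩⟩

section Models

variable {M : Type*} [L.Structure M]

theorem ternaryLT_irrefl [M ⊨ L.completeTheory ℚ] (x : M) : ¬ TernaryLT x x := by
  have h := realize_iff_of_model_completeTheory ℚ M (ltFormula 0 0).not.all
  simp only [Sentence.Realize, Formula.Realize, BoundedFormula.realize_all,
    BoundedFormula.realize_not, realize_ltFormula, ternaryLT_rat_iff] at h
  exact h.2 (fun _ => lt_irrefl _) x

theorem ternaryLT_trans [M ⊨ L.completeTheory ℚ] {x y z : M} (hxy : TernaryLT x y)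
    (hyz : TernaryLT y z) : TernaryLT x z := by
  have h := realize_iff_of_model_completeTheory ℚ M
    ((ltFormula 0 1).imp ((ltFormula 1 2).imp (ltFormula 0 2))).all.all.all
  simp only [Sentence.Realize, Formula.Realize, BoundedFormula.realize_all,
    BoundedFormula.realize_imp, realize_ltFormula, ternaryLT_rat_iff] at h
  exact h.2 (fun _ _ _ => lt_trans) x y z hxy hyz

theorem ternaryLT_trichotomy [M ⊨ L.completeTheory ℚ] (x y : M) :
    (TernaryLT x y ∨ x = y) ∨ TernaryLT y x := by
  have h := realize_iff_of_model_completeTheory ℚ M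
    ((ltFormula 0 1 ⊔ eqFormula 0 1) ⊔ ltFormula 1 0).all.all
  simp only [Sentence.Realize, Formula.Realize, BoundedFormula.realize_all,
    BoundedFormula.realize_sup, realize_ltFormula, realize_eqFormula, ternaryLT_rat_iff] at h
  exact h.2 (fun a b => or_assoc.2 (lt_trichotomy a b)) x y

theorem exists_ternaryLT_between [M ⊨ L.completeTheory ℚ] {x y : M} (hxy : TernaryLT x y) :
    ∃ z, TernaryLT x z ∧ TernaryLT z y := by
  have h := realize_iff_of_model_completeTheory ℚ M
    ((ltFormula 0 1).imp (ltFormula 0 2 ⊓ ltFormula 2 1).ex).all.all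
  simp only [Sentence.Realize, Formula.Realize, BoundedFormula.realize_all,
    BoundedFormula.realize_imp, BoundedFormula.realize_ex, BoundedFormula.realize_inf,
    realize_ltFormula, ternaryLT_rat_iff] at h
  exact h.2 (fun _ _ => exists_between) x y hxy

theorem exists_ternaryLT_right [M ⊨ L.completeTheory ℚ] (x : M) : ∃ y, TernaryLT x y := by
  have h := realize_iff_of_model_completeTheory ℚ M (ltFormula 0 1).ex.all
  simp only [Sentence.Realize, Formula.Realize, BoundedFormula.realize_all,
    BoundedFormula.realize_ex, realize_ltFormula, ternaryLT_rat_iff] at h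
  exact h.2 (fun a => exists_gt a) x

theorem exists_ternaryLT_left [M ⊨ L.completeTheory ℚ] (x : M) : ∃ y, TernaryLT y x := by
  have h := realize_iff_of_model_completeTheory ℚ M (ltFormula 1 0).ex.all
  simp only [Sentence.Realize, Formula.Realize, BoundedFormula.realize_all,
    BoundedFormula.realize_ex, realize_ltFormula, ternaryLT_rat_iff] at h
  exact h.2 (fun a => exists_lt a) x

theorem ternary_iff [M ⊨ L.completeTheory ℚ] (x y z : M) :
    Ternary x y z ↔ TernaryLT x y ∧ TernaryLT x z ∧ y ≠ z := by
  have h := realize_iff_of_model_completeTheory ℚ M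
    ((ternaryFormula 0 1 2).iff
      (ltFormula 0 1 ⊓ (ltFormula 0 2 ⊓ (eqFormula 1 2).not))).all.all.all
  simp only [Sentence.Realize, Formula.Realize, BoundedFormula.realize_all,
    BoundedFormula.realize_iff, BoundedFormula.realize_inf, BoundedFormula.realize_not,
    realize_ternaryFormula, realize_ltFormula, realize_eqFormula, ternaryLT_rat_iff] at h
  exact h.2 (fun _ _ _ => ternary_rat_iff _ _ _) x y z

variable (M)

/-- A model of the theory of `(ℚ, R)` is linearly ordered by `TernaryLT`. -/
@[reducible]
noncomputable def linearOrderOfModel [M ⊨ L.completeTheory ℚ] : LinearOrder M :=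
  haveI : IsStrictTotalOrder M TernaryLT :=
    { irrefl := ternaryLT_irrefl
      trans := fun _ _ _ => ternaryLT_trans
      trichotomous := fun x y hxy hyx =>
        ((ternaryLT_trichotomy x y).resolve_right hyx).resolve_left hxy }
  haveI := Classical.decRel (TernaryLT (M := M))
  linearOrderOfSTO TernaryLT

end Models

/-- Two nonempty countable models are isomorphic with respect to `TernaryLT`. -/
theorem exists_equiv_ternaryLT_iff (M N : Type*) [L.Structure M] [L.Structure N]
    [Countable M] [Nonempty M] [Countable N] [Nonempty N]
    [M ⊨ L.completeTheory ℚ] [N ⊨ L.completeTheory ℚ] :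
    ∃ e : M ≃ N, ∀ x y, TernaryLT (e x) (e y) ↔ TernaryLT x y := by
  let := linearOrderOfModel M
  let := linearOrderOfModel N
  have : DenselyOrdered M := ⟨fun _ _ => exists_ternaryLT_between⟩
  have : DenselyOrdered N := ⟨fun _ _ => exists_ternaryLT_between⟩
  have : NoMaxOrder M := ⟨exists_ternaryLT_right⟩
  have : NoMaxOrder N := ⟨exists_ternaryLT_right⟩
  have : NoMinOrder M := ⟨exists_ternaryLT_left⟩
  have : NoMinOrder N := ⟨exists_ternaryLT_left⟩
  obtain ⟨e⟩ := Order.iso_of_countable_dense M N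
  exact ⟨e.toEquiv, fun x y => e.lt_iff_lt⟩

end RatTernary

/-- The complete theory of `(ℚ, R)` is `ℵ₀`-categorical: any two countably infinite
models are isomorphic. -/
theorem stmt18 (M N : Type) [L.Structure M] [L.Structure N]
    [Countable M] [Infinite M] [Countable N] [Infinite N]
    (hM : M ⊨ L.completeTheory ℚ) (hN : N ⊨ L.completeTheory ℚ) :
    Nonempty (M ≃[L] N) := by
  obtain ⟨e, he⟩ := RatTernary.exists_equiv_ternaryLT_iff M N
  refine ⟨⟨e, fun f => f.elim, fun {_} rel xs => ?_⟩⟩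
  cases rel
  have ternary_map : ∀ x y z, RatTernary.Ternary (e x) (e y) (e z) ↔ RatTernary.Ternary x y z :=
    fun x y z => by simp only [RatTernary.ternary_iff, he, ne_eq, e.apply_eq_iff_eq]
  convert ternary_map (xs 0) (xs 1) (xs 2) using 1 <;> rw [RatTernary.Ternary] <;>
    congr! 1 <;> ext l <;> fin_cases l <;> rfl
end
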